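/- arXiv:2305.04983 — 3 statements merged into one kernel-verified Lean document; each statement's English description precedes it below -/
import Mathlib

section
/- Let F be a field, S ⊆ F a finite set with |S| = s ≥ 2, d ≥ 0, t = s³, and K = t(d+1). Suppose g : S^n → F has junta-degree at most d (with respect to the additive group of F) but is not degree-d, i.e., no polynomial of total degree at most d agrees with g on S^n. Then there exists a map μ : {1,…,n} → {1,…,K} such that the function g' : B(S,t)^{K/t} → F defined by g'(y) = g(y_{μ(1)},…,y_{μ(n)}) (where y ∈ B(S,t)^{K/t} is viewed as a point of S^K by flattening) is not degree-d: no polynomial in K variables of total degree at most d agrees with g' on B(S,t)^{K/t}. -/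
/-- A function `f` on a finite product domain `∀ i, D i` with values in an additive
abelian group `G` has junta-degree at most `d` if it is a finite sum of functions,
each depending on at most `d` of the coordinates. -/
def JuntaDegLE {n : ℕ} {D : Fin n → Type*} {G : Type*} [AddCommGroup G]
    (d : ℕ) (f : (∀ i, D i) → G) : Prop :=
  ∃ (t : ℕ) (Ds : Fin t → Finset (Fin n)) (fs : Fin t → (∀ i, D i) → G),
    (∀ j, (Ds j).card ≤ d) ∧
    (∀ j (x y : ∀ i, D i), (∀ i ∈ Ds j, x i = y i) → fs j x = fs j y) ∧
    ∀ x, f x = ∑ j, fs j x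

/-- `z ∈ S^t` is a balanced tuple if it contains each element of `S` exactly
`t / |S|` times. -/
def IsBalancedTuple {F : Type*} [DecidableEq F] (S : Finset F) (t : ℕ)
    (z : Fin t → F) : Prop :=
  (∀ i, z i ∈ S) ∧
  ∀ a ∈ S, (Finset.univ.filter (fun i => z i = a)).card = t / S.card

open Finset in
lemma sum_val_le_sum_of_injective {s : ℕ} (ε : Fin s → ℕ) (hε : Function.Injective ε) :
    ∑ k : Fin s, (k : ℕ) ≤ ∑ k, ε k := by
  rw [← Equiv.sum_comp (Tuple.sort ε) ε]
  have hmono : StrictMono (ε ∘ Tuple.sort ε) :=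
    (Tuple.monotone_sort ε).strictMono_of_injective (hε.comp (Equiv.injective _))
  have key : ∀ (m : ℕ) (hm : m < s), m ≤ (ε ∘ Tuple.sort ε) ⟨m, hm⟩ := by
    intro m
    induction m with
    | zero => intro _; exact Nat.zero_le _
    | succ m ih =>
      intro hm
      have h1 := ih (by omega)
      have h2 : (ε ∘ Tuple.sort ε) ⟨m, by omega⟩ < (ε ∘ Tuple.sort ε) ⟨m + 1, hm⟩ :=
        hmono (by simp [Fin.lt_def])
      omega
  exact sum_le_sum fun k _ => key k k.2

/-- The alternating sum of a monomial over all permutations of the point `v`. -/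
def alternatingSum {F : Type*} [Field F] {s : ℕ} (v : Fin s → F) (ε : Fin s → ℕ) : F :=
  ∑ σ : Equiv.Perm (Fin s), ((Equiv.Perm.sign σ : ℤ) : F) * ∏ k, v (σ k) ^ ε k

lemma alternatingSum_eq_det {F : Type*} [Field F] {s : ℕ} (v : Fin s → F) (ε : Fin s → ℕ) :
    alternatingSum v ε = (Matrix.of fun i k => v i ^ ε k).det := by
  simp [alternatingSum, Matrix.det_apply']

lemma alternatingSum_eq_zero {F : Type*} [Field F] {s : ℕ} (v : Fin s → F) (ε : Fin s → ℕ)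
    (h : ∑ k, ε k < ∑ k : Fin s, (k : ℕ)) : alternatingSum v ε = 0 := by
  have hinj : ¬ Function.Injective ε := fun hi =>
    absurd (sum_val_le_sum_of_injective ε hi) (by omega)
  simp only [Function.Injective, not_forall] at hinj
  obtain ⟨i, j, hij, hne⟩ := hinj
  rw [alternatingSum_eq_det]
  exact Matrix.det_zero_of_column_eq hne fun k => by simp [hij]

lemma alternatingSum_val_ne_zero {F : Type*} [Field F] {s : ℕ} (v : Fin s → F)
    (hv : Function.Injective v) : alternatingSum v (fun k => (k : ℕ)) ≠ 0 := by
  rw [alternatingSum_eq_det]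
  exact Matrix.det_vandermonde_ne_zero_iff.2 hv

open Finset in
/-- Every function on a finite grid is a combination of monomials with small exponents. -/
lemma exists_reduced_coeffs {F : Type*} [Field F] [DecidableEq F] (S : Finset F) {m : ℕ}
    (h : (Fin m → ↥S) → F) :
    ∃ c : (Fin m → Fin S.card) → F,
      ∀ z, h z = ∑ e, c e * ∏ j, (z j : F) ^ (e j : ℕ) := by
  have hL : ∀ a z : ↥S, ∑ k : Fin S.card, (Lagrange.basis S id (a : F)).coeff k * (z : F) ^ (k : ℕ)
      = if a = z then 1 else 0 := by
    intro a z
    have hdeg : (Lagrange.basis S id (a : F)).natDegree < S.card := by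
      have hpos : 0 < S.card := card_pos.2 ⟨a, a.2⟩
      have := Polynomial.natDegree_eq_of_degree_eq_some
        (Lagrange.degree_basis (v := id) (Set.injOn_id _) a.2)
      omega
    rw [Fin.sum_univ_eq_sum_range
      (fun k => (Lagrange.basis S id (a : F)).coeff k * (z : F) ^ k) S.card,
      ← Polynomial.eval_eq_sum_range' hdeg]
    split_ifs with haz
    · subst haz
      exact Lagrange.eval_basis_self (v := id) (Set.injOn_id _) a.2
    · exact Lagrange.eval_basis_of_ne (v := id) (fun hh => haz (Subtype.ext hh)) z.2
  refine ⟨fun e => ∑ w, h w * ∏ j, (Lagrange.basis S id (w j : F)).coeff (e j), fun z => ?_⟩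
  simp_rw [sum_mul]
  rw [sum_comm]
  simp_rw [mul_assoc, ← prod_mul_distrib, ← mul_sum]
  have hprod : ∀ w : Fin m → ↥S, ∑ e : Fin m → Fin S.card,
      ∏ j, (Lagrange.basis S id (w j : F)).coeff (e j) * (z j : F) ^ (e j : ℕ) =
        ∏ j, if w j = z j then 1 else 0 := by
    intro w
    rw [← Fintype.prod_sum fun (j : Fin m) (k : Fin S.card) =>
      (Lagrange.basis S id (w j : F)).coeff k * (z j : F) ^ (k : ℕ)]
    exact prod_congr rfl fun j _ => hL _ _
  simp_rw [hprod]
  rw [sum_eq_single z]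
  · simp
  · intro w _ hw
    obtain ⟨j, hj⟩ := Function.ne_iff.1 hw
    rw [prod_eq_zero (mem_univ j) (if_neg hj), mul_zero]
  · simp

/-- Functions on a grid that agree with a polynomial of total degree at most `d`. -/
def gridDegreeLE {F : Type*} [Field F] (S : Finset F) (n d : ℕ) :
    Submodule F ((Fin n → ↥S) → F) where
  carrier := {f | ∃ P : MvPolynomial (Fin n) F, P.totalDegree ≤ d ∧
      ∀ x : Fin n → ↥S, MvPolynomial.eval (fun i => (x i : F)) P = f x}
  zero_mem' := ⟨0, by simp, by simp⟩
  add_mem' := by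
    rintro f g ⟨P, hP, hPf⟩ ⟨Q, hQ, hQg⟩
    exact ⟨P + Q, (MvPolynomial.totalDegree_add P Q).trans (max_le hP hQ), fun x => by
      simp [hPf, hQg]⟩
  smul_mem' := by
    rintro a f ⟨P, hP, hPf⟩
    exact ⟨a • P, (MvPolynomial.totalDegree_smul_le a P).trans hP, fun x => by simp [hPf]⟩

/-- Fixing all coordinates outside `A` to the value `s₀`. -/
def fixOutside {F : Type*} {S : Finset F} {n : ℕ} (s₀ : ↥S) (g : (Fin n → ↥S) → F)
    (A : Finset (Fin n)) : (Fin n → ↥S) → F :=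
  fun x => g (fun i => if i ∈ A then x i else s₀)

open Finset in
lemma sum_fixOutside_eq_zero {F : Type*} [Field F] {S : Finset F} {n d : ℕ} (s₀ : ↥S)
    {g : (Fin n → ↥S) → F} (hg : JuntaDegLE d g) {A : Finset (Fin n)} (hA : d < A.card) :
    ∑ B ∈ A.powerset, (-1 : F) ^ B.card • fixOutside s₀ g B = 0 := by
  obtain ⟨t, Ds, fs, hcard, hdep, hsum⟩ := hg
  ext x
  simp only [Finset.sum_apply, Pi.smul_apply, fixOutside, hsum, smul_eq_mul, mul_sum, Pi.zero_apply]
  rw [sum_comm]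
  refine sum_eq_zero fun j _ => ?_
  obtain ⟨i, hiA, hiD⟩ : ∃ i ∈ A, i ∉ Ds j := by
    by_contra! hcon
    exact absurd (card_le_card (show A ⊆ Ds j from hcon)) (by have := hcard j; omega)
  obtain ⟨A', hi, rfl⟩ : ∃ A', i ∉ A' ∧ insert i A' = A :=
    ⟨A.erase i, notMem_erase _ _, insert_erase hiA⟩
  rw [sum_powerset_insert hi, ← sum_add_distrib]
  refine sum_eq_zero fun B hB => ?_
  have hiB : i ∉ B := fun h => hi (mem_powerset.1 hB h)
  rw [card_insert_of_notMem hiB, hdep j (fun k => if k ∈ insert i B then x k else s₀)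
    (fun k => if k ∈ B then x k else s₀) (fun k hk => by
      have : k ≠ i := fun h => hiD (h ▸ hk)
      simp [this])]
  ring

open Finset in
lemma mem_gridDegreeLE_of_fixOutside {F : Type*} [Field F] {S : Finset F} {n d : ℕ} (s₀ : ↥S)
    {g : (Fin n → ↥S) → F} (hg : JuntaDegLE d g)
    (h : ∀ A : Finset (Fin n), A.card ≤ d → fixOutside s₀ g A ∈ gridDegreeLE S n d) :
    g ∈ gridDegreeLE S n d := by
  have key : ∀ A : Finset (Fin n), fixOutside s₀ g A ∈ gridDegreeLE S n d := by
    intro A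
    induction A using Finset.strongInduction with
    | H A ih =>
      rcases le_or_gt A.card d with hA | hA
      · exact h A hA
      have h0 := sum_fixOutside_eq_zero s₀ hg hA
      rw [← sum_erase_add _ _ (mem_powerset_self A)] at h0
      have hmem : (-1 : F) ^ A.card • fixOutside s₀ g A ∈ gridDegreeLE S n d := by
        rw [eq_neg_of_add_eq_zero_right h0]
        refine Submodule.neg_mem _ (Submodule.sum_mem _ fun B hB => Submodule.smul_mem _ _ ?_)
        rw [mem_erase, mem_powerset] at hB
        exact ih B (hB.2.ssubset_of_ne hB.1)
      exact (Submodule.smul_mem_iff _ (pow_ne_zero _ (by simp))).1 hmem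
  have huniv : fixOutside s₀ g univ = g := by
    ext x
    simp [fixOutside]
  exact huniv ▸ key univ

open Finset MvPolynomial in
/-- Substituting coordinates or constants into a degree-`d` expression keeps degree `d`. -/
lemma subst_mem_gridDegreeLE {F : Type*} [Field F] {S : Finset F} {n m r d : ℕ}
    (c : (Fin m → Fin r) → F) (hc : ∀ e, c e ≠ 0 → ∑ j, (e j : ℕ) ≤ d)
    (z : (Fin n → ↥S) → Fin m → ↥S)
    (hz : ∀ j, (∃ i, ∀ x, z x j = x i) ∨ ∃ a, ∀ x, z x j = a) :
    (fun x => ∑ e, c e * ∏ j, (z x j : F) ^ (e j : ℕ)) ∈ gridDegreeLE S n d := by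
  have hq : ∀ j, ∃ q : MvPolynomial (Fin n) F, q.totalDegree ≤ 1 ∧
      ∀ x : Fin n → ↥S, eval (fun i => (x i : F)) q = z x j := by
    intro j
    rcases hz j with ⟨i, hi⟩ | ⟨a, ha⟩
    · exact ⟨X i, by simp, fun x => by simp [hi]⟩
    · exact ⟨C (a : F), by simp, fun x => by simp [ha]⟩
  choose q hq1 hq2 using hq
  have heq : (fun x => ∑ e, c e * ∏ j, (z x j : F) ^ (e j : ℕ)) =
      ∑ e, c e • fun x => ∏ j, (z x j : F) ^ (e j : ℕ) := by
    ext x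
    simp
  rw [heq]
  refine Submodule.sum_mem _ fun e _ => ?_
  by_cases he : c e = 0
  · simp [he]
  refine Submodule.smul_mem _ _ ⟨∏ j, q j ^ (e j : ℕ), ?_, fun x => by simp [hq2]⟩
  refine (totalDegree_finsetProd _ _).trans (le_trans (sum_le_sum fun j _ => ?_) (hc e he))
  exact (totalDegree_pow _ _).trans (by simpa using Nat.mul_le_mul_left (e j : ℕ) (hq1 j))

lemma exists_block_map {n d : ℕ} (A : Finset (Fin n)) (hA : A.card ≤ d) :
    ∃ c : Fin n → Fin (d + 1), (∀ i ∈ A, ∀ i', c i' = c i → i' = i) := by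
  classical
  let f := A.equivFin
  refine ⟨fun i => if h : i ∈ A then ⟨f ⟨i, h⟩, by omega⟩ else Fin.last d, ?_⟩
  intro i hi i' h
  have hlt := (f ⟨i, hi⟩).2
  by_cases hi' : i' ∈ A
  · simp only [hi, hi', dif_pos, Fin.mk.injEq] at h
    simpa using f.injective (Fin.ext h)
  · simp only [hi, hi', dif_pos, dif_neg, not_false_eq_true, Fin.ext_iff, Fin.val_last] at h
    omega

open Finset in
lemma sum_perm_mul_prod_eq {F : Type*} [Field F] {m s : ℕ} (v : Fin s → F)
    (w a : Fin m → Fin s → ℕ) :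
    ∑ σ : Fin m → Equiv.Perm (Fin s),
      (∏ j, (((Equiv.Perm.sign (σ j) : ℤ) : F) * ∏ k, v (σ j k) ^ w j k)) *
        ∏ j, ∏ k, v (σ j k) ^ a j k = ∏ j, alternatingSum v (fun k => w j k + a j k) := by
  simp only [alternatingSum]
  rw [Fintype.prod_sum]
  refine sum_congr rfl fun σ _ => ?_
  simp only [prod_mul_distrib, pow_add, mul_assoc]

open Finset in
/-- If a polynomial of degree at most `d` agrees, on a product of permutation orbits, with a
reduced polynomial in one distinguished coordinate per orbit, then the reduced polynomial has
degree at most `d`. -/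
lemma sum_exponents_le_of_agree {F : Type*} [Field F] {m s d : ℕ} {κ : Type*} [Fintype κ]
    (v : Fin s → F) (hv : Function.Injective v) (k₀ : Fin s)
    (hk₀ : (k₀ : ℕ) + 1 = s) (ι : Fin m × Fin s → κ) (hι : Function.Injective ι) (u : κ → F)
    (pt : (Fin m → Equiv.Perm (Fin s)) → κ → F)
    (hpt : ∀ σ j k, pt σ (ι (j, k)) = v (σ j k))
    (hpt' : ∀ σ x, x ∉ Set.range ι → pt σ x = u x)
    (P : MvPolynomial κ F) (hP : P.totalDegree ≤ d) (c : (Fin m → Fin s) → F)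
    (hagree : ∀ σ, MvPolynomial.eval (pt σ) P = ∑ e, c e * ∏ j, v (σ j k₀) ^ (e j : ℕ)) :
    ∀ e, c e ≠ 0 → ∑ j, (e j : ℕ) ≤ d := by
  classical
  by_contra! hcon
  obtain ⟨e, he, hmax⟩ := exists_max_image (univ.filter fun e => c e ≠ 0)
    (fun e => ∑ j, (e j : ℕ)) (by obtain ⟨e, he, -⟩ := hcon; exact ⟨e, by simp [he]⟩)
  replace he : c e ≠ 0 := by simpa using he
  have hed : d < ∑ j, (e j : ℕ) := by
    obtain ⟨e', he', hlt⟩ := hcon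
    exact hlt.trans_le (hmax e' (by simp [he']))
  let single (n : ℕ) : Fin s → ℕ := fun k => if k = k₀ then n else 0
  have hsingle : ∀ n, ∑ k, single n k = n := fun n => by simp [single]
  let w : Fin m → Fin s → ℕ := fun j k => k - single (e j) k
  have hw : ∀ j k, w j k + single (e j) k = k := by
    intro j k
    have := (e j).2
    simp only [w, single]
    split_ifs with h
    · subst h; omega
    · omega
  have hwsum : ∀ j, ∑ k, w j k + e j = ∑ k : Fin s, (k : ℕ) := by
    intro j
    rw [← hsingle (e j), ← sum_add_distrib]
    exact sum_congr rfl fun k _ => hw j k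
  have hvanish : ∀ a : Fin m → Fin s → ℕ, (∃ j, ∑ k, a j k < e j) →
      ∏ j, alternatingSum v (fun k => w j k + a j k) = 0 := by
    rintro a ⟨j, hj⟩
    refine prod_eq_zero (mem_univ j) (alternatingSum_eq_zero _ _ ?_)
    rw [sum_add_distrib, ← hwsum j]
    omega
  let wt : (Fin m → Equiv.Perm (Fin s)) → F := fun σ =>
    ∏ j, (((Equiv.Perm.sign (σ j) : ℤ) : F) * ∏ k, v (σ j k) ^ w j k)
  have hleft : ∑ σ, wt σ * MvPolynomial.eval (pt σ) P = 0 := by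
    simp_rw [MvPolynomial.eval_eq', mul_sum]
    rw [sum_comm]
    refine sum_eq_zero fun μ hμ => ?_
    have hsplit : ∀ σ, ∏ x, pt σ x ^ μ x =
        (∏ j, ∏ k, v (σ j k) ^ μ (ι (j, k))) * ∏ x ∈ (univ.image ι)ᶜ, u x ^ μ x := by
      intro σ
      rw [← prod_mul_prod_compl (univ.image ι), prod_image hι.injOn,
        Fintype.prod_prod_type]
      congr 1
      · simp_rw [hpt]
      · refine prod_congr rfl fun x hx => ?_
        rw [hpt' σ x (by simpa using hx)]
    have hdeg : ∑ j, ∑ k, μ (ι (j, k)) ≤ d := by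
      have h1 := (MvPolynomial.le_totalDegree hμ).trans hP
      rw [Finsupp.sum_fintype _ _ (fun _ => rfl)] at h1
      refine le_trans ?_ h1
      rw [← Fintype.sum_prod_type (fun p => μ (ι p)), ← sum_image (f := fun x => μ x) hι.injOn]
      exact sum_le_sum_of_subset (subset_univ _)
    have hfac : ∀ σ, wt σ * (P.coeff μ * ∏ x, pt σ x ^ μ x) =
        (wt σ * ∏ j, ∏ k, v (σ j k) ^ μ (ι (j, k))) *
          (P.coeff μ * ∏ x ∈ (univ.image ι)ᶜ, u x ^ μ x) := by
      intro σ
      rw [hsplit]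
      ring
    simp_rw [hfac]
    rw [← sum_mul, sum_perm_mul_prod_eq v w fun j k => μ (ι (j, k)), hvanish, zero_mul]
    by_contra! hall
    exact absurd (sum_le_sum fun j (_ : j ∈ univ) => hall j) (by omega)
  have hright : ∑ σ, wt σ * ∑ e', c e' * ∏ j, v (σ j k₀) ^ (e' j : ℕ) =
      c e * ∏ _j : Fin m, alternatingSum v (fun k => (k : ℕ)) := by
    simp_rw [mul_sum]
    rw [sum_comm]
    have hterm : ∀ e' : Fin m → Fin s,
        ∑ σ, wt σ * (c e' * ∏ j, v (σ j k₀) ^ (e' j : ℕ)) =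
          c e' * ∏ j, alternatingSum v (fun k => w j k + single (e' j) k) := by
      intro e'
      rw [← sum_perm_mul_prod_eq v w fun j k => single (e' j) k, mul_sum]
      refine sum_congr rfl fun σ _ => ?_
      have : ∀ j, ∏ k, v (σ j k) ^ single (e' j) k = v (σ j k₀) ^ (e' j : ℕ) := by
        intro j
        rw [prod_eq_single k₀ (fun k _ hk => by simp [single, hk]) (by simp)]
        simp [single]
      simp_rw [this]
      ring
    simp_rw [hterm]
    rw [sum_eq_single e]
    · simp_rw [hw]
    · intro e' _ hne
      by_cases hc : c e' = 0
      · simp [hc]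
      rw [hvanish, mul_zero]
      by_contra! hall
      simp_rw [hsingle] at hall
      have hle : ∑ j, (e' j : ℕ) ≤ ∑ j, (e j : ℕ) := hmax e' (by simp [hc])
      have heq := (sum_eq_sum_iff_of_le fun j _ => hall j).1
        (le_antisymm (sum_le_sum fun j _ => hall j) hle)
      exact hne (funext fun j => Fin.ext (heq j (mem_univ j)).symm)
    · simp
  simp_rw [hagree] at hleft
  rw [hleft] at hright
  exact mul_ne_zero he (prod_ne_zero_iff.2 fun _ _ => alternatingSum_val_ne_zero v hv) hright.symm

open Finset in
lemma card_filter_block_eq {α : Type*} [DecidableEq α] {s r t : ℕ} (v : Fin s → α)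
    (hv : Function.Injective v) (E : Fin s × Fin r ≃ Fin t) (r₀ : Fin r)
    (τ : Equiv.Perm (Fin s)) (b : Fin s) :
    (univ.filter fun i => v (if (E.symm i).2 = r₀ then τ (E.symm i).1 else (E.symm i).1)
      = v b).card = r := by
  refine Eq.trans (card_nbij' (t := (univ : Finset (Fin r))) (fun i => (E.symm i).2) (fun ρ => E (if ρ = r₀ then τ.symm b else b, ρ))
    (fun _ _ => by simp) (fun ρ _ => ?_) (fun i hi => ?_) (fun ρ _ => by simp))
    (card_fin r)
  · by_cases h : ρ = r₀ <;> simp [h]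
  · have hb := hv (mem_filter.1 hi).2
    refine E.eq_symm_apply.1 ?_
    rw [← hb]
    by_cases h : (E.symm i).2 = r₀ <;> simp [h, Prod.ext_iff]

theorem stmt12 {F : Type*} [Field F] [DecidableEq F] (S : Finset F) (s : ℕ)
    (hs : 2 ≤ s) (hS : S.card = s) {n : ℕ} (d t K : ℕ)
    (ht : t = s ^ 3) (hK : K = t * (d + 1))
    (g : (Fin n → ↥S) → F) (hjd : JuntaDegLE d g)
    (hnd : ¬ ∃ P : MvPolynomial (Fin n) F, P.totalDegree ≤ d ∧
      ∀ x : Fin n → ↥S, MvPolynomial.eval (fun i => (x i : F)) P = g x) :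
    ∃ μ : Fin n → Fin (d + 1) × Fin t,
      ¬ ∃ P : MvPolynomial (Fin (d + 1) × Fin t) F, P.totalDegree ≤ d ∧
        ∀ y : Fin (d + 1) × Fin t → ↥S,
          (∀ j : Fin (d + 1), IsBalancedTuple S t (fun i => (y (j, i) : F))) →
          MvPolynomial.eval (fun v => (y v : F)) P = g (fun i => y (μ i)) := by
  subst hS
  by_contra hcon
  rw [not_exists] at hcon
  have htmul : S.card * S.card ^ 2 = t := by rw [ht]; ring
  have hdiv : t / S.card = S.card ^ 2 := by
    rw [← htmul, Nat.mul_div_cancel_left _ (by omega)]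
  let E : Fin S.card × Fin (S.card ^ 2) ≃ Fin t := finProdFinEquiv.trans (finCongr htmul)
  let v : Fin S.card ≃ ↥S := S.equivFin.symm
  let k₀ : Fin S.card := ⟨S.card - 1, by omega⟩
  let r₀ : Fin (S.card ^ 2) := ⟨0, by positivity⟩
  refine hnd (mem_gridDegreeLE_of_fixOutside (v k₀) hjd fun A hA => ?_)
  obtain ⟨c, hc⟩ := exists_block_map A hA
  obtain ⟨P, hPd, hP⟩ := not_not.1 (hcon fun i => (c i, E (k₀, r₀)))
  obtain ⟨γ, hγ⟩ := exists_reduced_coeffs S fun z : Fin (d + 1) → ↥S => g fun i => z (c i)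
  let y : (Fin (d + 1) → Equiv.Perm (Fin S.card)) → Fin (d + 1) × Fin t → ↥S := fun σ p =>
    v (if (E.symm p.2).2 = r₀ then σ p.1 (E.symm p.2).1 else (E.symm p.2).1)
  have hvF : Function.Injective fun k => (v k : F) := Subtype.val_injective.comp v.injective
  have hbal : ∀ σ j, IsBalancedTuple S t (fun i => (y σ (j, i) : F)) := by
    refine fun σ j => ⟨fun i => (y σ (j, i)).2, fun a ha => ?_⟩
    rw [hdiv]
    simpa [y] using card_filter_block_eq (fun k => (v k : F)) hvF E r₀ (σ j) (v.symm ⟨a, ha⟩)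
  have hγd := sum_exponents_le_of_agree (fun k => (v k : F)) hvF k₀
    (Nat.sub_add_cancel (by omega)) (fun p => (p.1, E (p.2, r₀)))
    (fun p q h => by simpa [Prod.ext_iff] using h) (fun p => (v (E.symm p.2).1 : F))
    (fun σ p => (y σ p : F)) (fun σ j k => by simp [y])
    (fun σ p hp => by
      have : (E.symm p.2).2 ≠ r₀ := fun h => hp ⟨(p.1, (E.symm p.2).1), by simp [← h]⟩
      simp [y, this])
    P hPd γ (fun σ => by
      rw [hP (y σ) (hbal σ), ← hγ fun j => v (σ j k₀)]
      simp [y])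
  classical
  let z : (Fin n → ↥S) → Fin (d + 1) → ↥S := fun x j =>
    if h : ∃ i ∈ A, c i = j then x h.choose else v k₀
  have hfix : fixOutside (v k₀) g A =
      fun x => ∑ e, γ e * ∏ j, (z x j : F) ^ (e j : ℕ) := by
    ext x
    rw [← hγ, fixOutside]
    congr 1
    ext i
    by_cases hi : i ∈ A
    · have h : ∃ i' ∈ A, c i' = c i := ⟨i, hi, rfl⟩
      simp only [z, hi, if_true, dif_pos h, hc i hi _ h.choose_spec.2]
    · have h : ¬ ∃ i' ∈ A, c i' = c i := by
        rintro ⟨i', hi', h⟩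
        exact hi (hc i' hi' i h.symm ▸ hi')
      simp only [z, hi, if_false, dif_neg h]
  rw [hfix]
  refine subst_mem_gridDegreeLE γ hγd z fun j => ?_
  by_cases h : ∃ i ∈ A, c i = j
  · exact Or.inl ⟨h.choose, fun x => by simp only [z, dif_pos h]⟩
  · exact Or.inr ⟨v k₀, fun x => by simp only [z, dif_neg h]⟩
end

section
/- Let s ≥ 3, n ≥ 1, and let m be a natural number with n/32 ≤ m ≤ n. Let A ⊆ (ZMod s)^n and set δ = |A|/s^n. Let x be uniformly random on (ZMod s)^n and, given x, let y be uniformly random on the Hamming sphere {y ∈ (ZMod s)^n : Δ(x,y) = m}. Then Pr[x ∈ A and y ∈ A] ≤ 2·δ^{1+λ}, where λ = 1/(2^{14}·log₂ s). -/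
open Finset

/-- Second-order lower bound for `t ↦ t ^ p` around `1` on the interval `[0, N]`. -/
lemma rpow_ge_quadratic {p N t : ℝ} (hp1 : 1 < p) (hp2 : p ≤ 2) (hN : 1 < N) (ht0 : 0 ≤ t)
    (htN : t ≤ N) :
    1 + p * (t - 1) + p * (p - 1) * N ^ (p - 2) / 2 * (t - 1) ^ 2 ≤ t ^ p := by
  set c := p * (p - 1) * N ^ (p - 2) with hc
  let G : ℝ → ℝ := fun t => t ^ p - (1 + p * (t - 1) + c / 2 * (t - 1) ^ 2)
  let G' : ℝ → ℝ := fun t => p * t ^ (p - 1) - (p + c * (t - 1))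
  have hG : ∀ x, 0 < x → HasDerivAt G (G' x) x := by
    intro x hx
    have h1 := Real.hasDerivAt_rpow_const (x := x) (p := p) (Or.inl hx.ne')
    have h0 := (hasDerivAt_id x).sub_const 1
    have h2 := ((h0.const_mul p).const_add 1).add ((h0.pow 2).const_mul (c / 2))
    refine (h1.sub h2).congr_deriv ?_
    simp only [G', id]
    push_cast
    ring
  have hG' : ∀ x, 0 < x → HasDerivAt G' (p * (p - 1) * x ^ (p - 2) - c) x := by
    intro x hx
    have h1 := (Real.hasDerivAt_rpow_const (x := x) (p := p - 1) (Or.inl hx.ne')).const_mul p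
    have h0 := (hasDerivAt_id x).sub_const 1
    refine (h1.sub ((h0.const_mul c).const_add p)).congr_deriv ?_
    rw [show p - 1 - 1 = p - 2 by ring]
    ring
  have hconv : ConvexOn ℝ (Set.Icc 0 N) G := by
    refine convexOn_of_hasDerivWithinAt2_nonneg (convex_Icc 0 N) (f' := G')
      (f'' := fun x => p * (p - 1) * x ^ (p - 2) - c) ?_ ?_ ?_ ?_
    · refine ContinuousOn.sub (Real.continuous_rpow_const (by linarith)).continuousOn ?_
      fun_prop
    · intro x hx
      rw [interior_Icc] at hx
      exact (hG x hx.1).hasDerivWithinAt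
    · intro x hx
      rw [interior_Icc] at hx
      exact (hG' x hx.1).hasDerivWithinAt
    · intro x hx
      rw [interior_Icc] at hx
      have := Real.rpow_le_rpow_of_nonpos hx.1 hx.2.le (show p - 2 ≤ 0 by linarith)
      have h3 : 0 ≤ p * (p - 1) := by nlinarith
      have := mul_le_mul_of_nonneg_left this h3
      simp only [hc]
      linarith
  have hG1 : HasDerivAt G 0 1 := by
    have := hG 1 one_pos
    simpa [G'] using this
  have hG10 : G 1 = 0 := by simp [G]
  have key : 0 ≤ G t := by
    rcases lt_trichotomy t 1 with h | h | h
    · have := hconv.slope_le_of_hasDerivAt ⟨ht0, htN⟩ ⟨zero_le_one, hN.le⟩ h hG1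
      rw [slope_def_field, hG10, div_nonpos_iff] at this
      rcases this with h' | h' <;> linarith [h'.1, h'.2]
    · rw [h, hG10]
    · have := hconv.le_slope_of_hasDerivAt ⟨zero_le_one, hN.le⟩ ⟨ht0, htN⟩ h hG1
      rw [slope_def_field, hG10, div_nonneg_iff] at this
      rcases this with h' | h' <;> linarith [h'.1, h'.2]
  simp only [G] at key
  linarith

/-- On a finite uniform probability space, the square of the `L^p` norm dominates a convex
combination of the squares of the `L²` and `L¹` norms. -/
lemma mean_sq_le_mean_rpow {Ω : Type*} [Fintype Ω] (hΩ : 1 < Fintype.card Ω) {p ρ : ℝ}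
    (hp1 : 1 < p) (hp2 : p ≤ 2) (hρ : ρ ≤ (p - 1) * (Fintype.card Ω : ℝ) ^ (p - 2))
    (h : Ω → ℝ) (hh : ∀ x, 0 ≤ h x) :
    ρ * ((∑ x, h x ^ 2) / Fintype.card Ω) + (1 - ρ) * ((∑ x, h x) / Fintype.card Ω) ^ 2
      ≤ ((∑ x, h x ^ p) / Fintype.card Ω) ^ (2 / p) := by
  set N : ℝ := (Fintype.card Ω : ℝ) with hN
  have hN1 : 1 < N := by rw [hN]; exact_mod_cast hΩ
  have hN0 : 0 < N := by linarith
  have hS0 : 0 ≤ ∑ x, h x := sum_nonneg fun x _ => hh x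
  rcases hS0.eq_or_lt with hS | hS
  · have hz : ∀ x, h x = 0 := fun x =>
      (sum_eq_zero_iff_of_nonneg fun x _ => hh x).1 hS.symm x (mem_univ x)
    simp only [hz]
    simp [Real.zero_rpow (show p ≠ 0 by linarith)]
    positivity
  set μ := (∑ x, h x) / N with hμ
  have hμ0 : 0 < μ := div_pos hS hN0
  have hsum : ∑ x, h x = μ * N := by rw [hμ]; field_simp
  have hpt : ∀ x, 1 + p * (h x / μ - 1) + p * (p - 1) * N ^ (p - 2) / 2 * (h x / μ - 1) ^ 2
      ≤ (h x / μ) ^ p := by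
    intro x
    refine rpow_ge_quadratic hp1 hp2 hN1 (div_nonneg (hh x) hμ0.le) ?_
    rw [div_le_iff₀ hμ0, mul_comm, ← hsum]
    exact single_le_sum (fun x _ => hh x) (mem_univ x)
  have hs := sum_le_sum fun x (_ : x ∈ univ) => hpt x
  set B := (∑ x, h x ^ 2) / N with hB
  have hBs : ∑ x, h x ^ 2 = B * N := by rw [hB]; field_simp
  set P := (∑ x, h x ^ p) / N with hP
  have hPs : ∑ x, h x ^ p = P * N := by rw [hP]; field_simp
  have e1 : ∑ x, (h x / μ) ^ p = P / μ ^ p * N := by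
    simp_rw [Real.div_rpow (hh _) hμ0.le, ← sum_div, hPs]
    ring
  have e2 : ∑ x, (1 + p * (h x / μ - 1) + p * (p - 1) * N ^ (p - 2) / 2 * (h x / μ - 1) ^ 2)
      = N * (1 + p * (p - 1) * N ^ (p - 2) / 2 * (B / μ ^ 2 - 1)) := by
    have : ∀ x, (1 + p * (h x / μ - 1) + p * (p - 1) * N ^ (p - 2) / 2 * (h x / μ - 1) ^ 2)
        = (1 - p + p * (p - 1) * N ^ (p - 2) / 2)
          + (p / μ - p * (p - 1) * N ^ (p - 2) / μ) * h x
          + (p * (p - 1) * N ^ (p - 2) / 2 / μ ^ 2) * h x ^ 2 := by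
      intro x; field_simp; ring
    simp_rw [this, sum_add_distrib, ← mul_sum, hsum, hBs]
    simp only [sum_const, card_univ, nsmul_eq_mul, ← hN]
    field_simp
    ring
  rw [e1, e2, mul_comm, mul_le_mul_iff_left₀ hN0] at hs
  have hvar : 1 ≤ B / μ ^ 2 := by
    rw [one_le_div (by positivity), hμ, hB, div_pow, div_le_div_iff₀ (by positivity) hN0]
    have := sq_sum_le_card_mul_sum_sq (s := univ) (f := h)
    rw [card_univ, ← hN] at this
    nlinarith
  have hc0 : 0 ≤ (p - 1) * N ^ (p - 2) := mul_nonneg (by linarith) (by positivity)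
  have hP0 : 0 ≤ P := div_nonneg (sum_nonneg fun x _ => Real.rpow_nonneg (hh x) _) hN0.le
  have hbern := one_add_mul_self_le_rpow_one_add (s := P / μ ^ p - 1) (by
    have : 0 ≤ P / μ ^ p := by positivity
    linarith) (p := 2 / p) (by rw [le_div_iff₀ (by linarith)]; linarith)
  rw [add_sub_cancel, Real.div_rpow hP0 (by positivity), ← Real.rpow_mul hμ0.le,
    mul_div_cancel₀ _ (by linarith), Real.rpow_two] at hbern
  have h3 : 2 / p * (p * (p - 1) * N ^ (p - 2) / 2 * (B / μ ^ 2 - 1))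
      ≤ 2 / p * (P / μ ^ p - 1) :=
    mul_le_mul_of_nonneg_left (by linarith) (by have : 0 < p := by linarith
                                                positivity)
  have h4 : 2 / p * (p * (p - 1) * N ^ (p - 2) / 2 * (B / μ ^ 2 - 1))
      = (p - 1) * N ^ (p - 2) * (B / μ ^ 2 - 1) := by
    field_simp
  have h5 := mul_le_mul_of_nonneg_right hρ (sub_nonneg.2 hvar)
  have h6 : 1 + ρ * (B / μ ^ 2 - 1) ≤ P ^ (2 / p) / μ ^ 2 := by linarith
  rw [le_div_iff₀ (by positivity)] at h6
  calc ρ * B + (1 - ρ) * μ ^ 2 = (1 + ρ * (B / μ ^ 2 - 1)) * μ ^ 2 := by field_simp; ring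
    _ ≤ _ := h6

/-- The bilinear form summing `f x * g y` over pairs at Hamming distance one. -/
noncomputable def adjacencyForm {b s : ℕ} [NeZero s] (f g : (Fin b → ZMod s) → ℝ) : ℝ :=
  ∑ x, ∑ y, if hammingDist x y = 1 then f x * g y else 0

lemma hammingDist_cons {b : ℕ} {α : Type*} [DecidableEq α] (a c : α) (x y : Fin b → α) :
    hammingDist (Fin.cons a x : Fin (b + 1) → α) (Fin.cons c y)
      = (if a = c then 0 else 1) + hammingDist x y := by
  simp only [hammingDist, card_filter, Fin.sum_univ_succ, Fin.cons_zero, Fin.cons_succ]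
  congr 1
  split_ifs <;> simp_all

lemma sum_fin_succ_pi {b : ℕ} {α : Type*} [Fintype α] (F : (Fin (b + 1) → α) → ℝ) :
    ∑ x, F x = ∑ a, ∑ x : Fin b → α, F (Fin.cons a x) := by
  rw [← (Fin.consEquiv fun _ : Fin (b + 1) => α).sum_comp, Fintype.sum_prod_type]
  rfl

lemma adjacencyForm_succ {b s : ℕ} [NeZero s] (h : (Fin (b + 1) → ZMod s) → ℝ) :
    adjacencyForm h h
      = ∑ a, adjacencyForm (fun x => h (Fin.cons a x)) (fun x => h (Fin.cons a x))
        + ∑ x : Fin b → ZMod s, (∑ a, h (Fin.cons a x)) ^ 2 - ∑ x, h x ^ 2 := by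
  have key : ∀ a c : ZMod s, ∀ x y : Fin b → ZMod s,
      (if hammingDist (Fin.cons a x : Fin (b + 1) → ZMod s) (Fin.cons c y) = 1
        then h (Fin.cons a x) * h (Fin.cons c y) else 0)
      = (if a = c then (if hammingDist x y = 1 then h (Fin.cons a x) * h (Fin.cons a y) else 0)
          else 0)
        + (if x = y then h (Fin.cons a x) * h (Fin.cons c x) else 0)
        - (if a = c then (if x = y then h (Fin.cons a x) ^ 2 else 0) else 0) := by
    intro a c x y
    rw [hammingDist_cons]
    by_cases hac : a = c
    · subst hac
      by_cases hxy : x = y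
      · subst hxy; simp; ring
      · simp [hxy]
    · by_cases hxy : x = y
      · subst hxy; simp [hac]
      · simp [hac, hxy]
  have e1 : adjacencyForm h h = ∑ a, ∑ x : Fin b → ZMod s, ∑ c, ∑ y : Fin b → ZMod s,
      (if hammingDist (Fin.cons a x : Fin (b + 1) → ZMod s) (Fin.cons c y) = 1
        then h (Fin.cons a x) * h (Fin.cons c y) else 0) := by
    rw [adjacencyForm, sum_fin_succ_pi]
    simp_rw [sum_fin_succ_pi (fun y => ite _ _ _)]
  have e2 : ∑ x, h x ^ 2 = ∑ a, ∑ x : Fin b → ZMod s, h (Fin.cons a x) ^ 2 := sum_fin_succ_pi _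
  have e3 : ∑ x : Fin b → ZMod s, (∑ a, h (Fin.cons a x)) ^ 2
      = ∑ a, ∑ x : Fin b → ZMod s, ∑ c, h (Fin.cons a x) * h (Fin.cons c x) := by
    rw [sum_comm]
    simp_rw [sq, sum_mul_sum]
  rw [e1, e2, e3]
  simp_rw [key, sum_sub_distrib, sum_add_distrib]
  congr 1
  · congr 1
    · simp only [adjacencyForm]
      refine sum_congr rfl fun a _ => sum_congr rfl fun x _ => ?_
      rw [sum_comm]
      simp
    · simp
  · refine sum_congr rfl fun a _ => sum_congr rfl fun x _ => ?_
    rw [sum_comm]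
    simp

lemma neg_le_adjacencyForm {b s : ℕ} [NeZero s] (h : (Fin b → ZMod s) → ℝ) :
    -(b * ∑ x, h x ^ 2) ≤ adjacencyForm h h := by
  induction b with
  | zero => simp [adjacencyForm, hammingDist]
  | succ b ih =>
    rw [adjacencyForm_succ]
    have h1 := sum_le_sum fun a (_ : a ∈ (univ : Finset (ZMod s))) =>
      ih (fun x => h (Fin.cons a x))
    rw [sum_neg_distrib, ← mul_sum, ← sum_fin_succ_pi (fun x => h x ^ 2)] at h1
    have h2 : 0 ≤ ∑ x : Fin b → ZMod s, (∑ a, h (Fin.cons a x)) ^ 2 :=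
      sum_nonneg fun _ _ => sq_nonneg _
    push_cast
    linarith

/-- The Efron–Stein inequality for functions of two variables. -/
lemma efron_stein_two {α β : Type*} [Fintype α] [Fintype β] [Nonempty α] [Nonempty β]
    (F : α → β → ℝ) :
    (Fintype.card α : ℝ) / Fintype.card β * ∑ a, (∑ x, F a x) ^ 2 + ∑ x, (∑ a, F a x) ^ 2
      ≤ Fintype.card α * ∑ a, ∑ x, F a x ^ 2 + (∑ a, ∑ x, F a x) ^ 2 / Fintype.card β := by
  set C := (Fintype.card α : ℝ) with hC
  set X := (Fintype.card β : ℝ) with hX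
  have hC0 : 0 < C := by rw [hC]; exact_mod_cast Fintype.card_pos
  have hX0 : 0 < X := by rw [hX]; exact_mod_cast Fintype.card_pos
  set T := ∑ a, ∑ x, F a x with hT
  have hT' : ∑ x, ∑ a, F a x = T := sum_comm
  have h0 : 0 ≤ ∑ a, ∑ x, (F a x - (∑ y, F a y) / X - (∑ c, F c x) / C + T / (C * X)) ^ 2 :=
    sum_nonneg fun _ _ => sum_nonneg fun _ _ => sq_nonneg _
  have e : ∀ a x, (F a x - (∑ y, F a y) / X - (∑ c, F c x) / C + T / (C * X)) ^ 2
      = F a x ^ 2 + (∑ y, F a y) ^ 2 / X ^ 2 + (∑ c, F c x) ^ 2 / C ^ 2 + T ^ 2 / (C * X) ^ 2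
        - (2 / X) * (F a x * ∑ y, F a y) - (2 / C) * (F a x * ∑ c, F c x)
        + (2 * T / (C * X)) * F a x + (2 / (X * C)) * ((∑ y, F a y) * ∑ c, F c x)
        - (2 * T / (C * X ^ 2)) * (∑ y, F a y) - (2 * T / (C ^ 2 * X)) * (∑ c, F c x) := by
    intro a x
    field_simp
    ring
  have s2 : ∑ a, ∑ x, F a x * ∑ c, F c x = ∑ x, (∑ a, F a x) ^ 2 := by
    rw [sum_comm]
    simp_rw [← sum_mul, sq]
  simp only [e, sum_sub_distrib, sum_add_distrib, ← mul_sum, ← sum_mul, ← sum_div, s2, hT',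
    sum_const, card_univ, nsmul_eq_mul, ← hC, ← hX, ← hT, ← sq] at h0
  have h1 := mul_nonneg hC0.le h0
  refine sub_nonneg.1 (h1.trans_eq ?_)
  field_simp
  ring

lemma adjacencyForm_le {b s : ℕ} [NeZero s] (h : (Fin b → ZMod s) → ℝ) :
    adjacencyForm h h ≤ ((b - 1) * s - b) * ∑ x, h x ^ 2 + s / s ^ b * (∑ x, h x) ^ 2 := by
  induction b with
  | zero => simp [adjacencyForm, hammingDist]
  | succ b ih =>
    rw [adjacencyForm_succ]
    have h1 := sum_le_sum fun a (_ : a ∈ (univ : Finset (ZMod s))) =>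
      ih (fun x => h (Fin.cons a x))
    rw [sum_add_distrib, ← mul_sum, ← mul_sum, ← sum_fin_succ_pi (fun x => h x ^ 2)] at h1
    have h2 := efron_stein_two fun (a : ZMod s) (x : Fin b → ZMod s) => h (Fin.cons a x)
    rw [← sum_fin_succ_pi (fun x => h x ^ 2), ← sum_fin_succ_pi h] at h2
    simp only [Fintype.card_fun, ZMod.card, Fintype.card_fin, Nat.cast_pow] at h2
    have hs : (s : ℝ) ≠ 0 := by exact_mod_cast NeZero.ne s
    have h3 : (s : ℝ) / s ^ (b + 1) * (∑ x, h x) ^ 2 = (∑ x, h x) ^ 2 / s ^ b := by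
      rw [pow_succ]
      field_simp
    rw [h3]
    push_cast
    linarith

lemma adjacencyForm_comm {b s : ℕ} [NeZero s] (f g : (Fin b → ZMod s) → ℝ) :
    adjacencyForm f g = adjacencyForm g f := by
  simp only [adjacencyForm]
  rw [sum_comm]
  simp_rw [hammingDist_comm, mul_comm]

lemma adjacencyForm_polarization {b s : ℕ} [NeZero s] (f g : (Fin b → ZMod s) → ℝ) :
    4 * adjacencyForm f g
      = adjacencyForm (fun x => f x + g x) (fun x => f x + g x)
        - adjacencyForm (fun x => f x - g x) (fun x => f x - g x) := by
  have h : 4 * adjacencyForm f g = 2 * adjacencyForm f g + 2 * adjacencyForm g f := by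
    rw [adjacencyForm_comm g f]
    ring
  rw [h]
  simp only [adjacencyForm, mul_sum, ← sum_add_distrib, ← sum_sub_distrib]
  refine sum_congr rfl fun x _ => sum_congr rfl fun y _ => ?_
  split_ifs <;> ring

lemma abs_adjacencyForm_le {b s : ℕ} [NeZero s] (hs : 3 ≤ s) (hb1 : 1 ≤ b) (hb : b ≤ 32)
    (h : (Fin b → ZMod s) → ℝ) :
    |adjacencyForm h h|
      ≤ b * (s - 1) * (31 / 32 * ∑ x, h x ^ 2 + 1 / 32 * ((∑ x, h x) ^ 2 / s ^ b)) := by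
  have hl := neg_le_adjacencyForm h
  have hu := adjacencyForm_le h
  have hs' : (3 : ℝ) ≤ s := by exact_mod_cast hs
  have hb1' : (1 : ℝ) ≤ b := by exact_mod_cast hb1
  have hb' : (b : ℝ) ≤ 32 := by exact_mod_cast hb
  have hAB : (∑ x, h x) ^ 2 / s ^ b ≤ ∑ x, h x ^ 2 := by
    have := sq_sum_le_card_mul_sum_sq (s := univ) (f := h)
    simp only [card_univ, Fintype.card_fun, ZMod.card, Fintype.card_fin, Nat.cast_pow] at this
    rw [div_le_iff₀ (by positivity)]
    linarith
  have hA0 : 0 ≤ (∑ x, h x) ^ 2 / (s : ℝ) ^ b := by positivity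
  have hA : (s : ℝ) / s ^ b * (∑ x, h x) ^ 2 = s * ((∑ x, h x) ^ 2 / s ^ b) := by ring
  rw [hA] at hu
  set A := (∑ x, h x) ^ 2 / (s : ℝ) ^ b
  set B := ∑ x, h x ^ 2
  rw [abs_le]
  constructor
  · have h1 : 0 ≤ (b : ℝ) * (s - 1) * A := by
      have : (0 : ℝ) ≤ s - 1 := by linarith
      positivity
    have h2 : (b : ℝ) * B ≤ b * B * ((s - 1) * (31 / 32)) :=
      le_mul_of_one_le_right (mul_nonneg (by linarith) (hA0.trans hAB)) (by linarith)
    linarith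
  · have h1 : 0 ≤ (B - A) * ((s : ℝ) - b * (s - 1) / 32) := by
      refine mul_nonneg (by linarith) ?_
      nlinarith
    linarith

lemma adjacencyForm_le_mean {b s : ℕ} [NeZero s] (hs : 3 ≤ s) (hb1 : 1 ≤ b) (hb : b ≤ 32)
    (f g : (Fin b → ZMod s) → ℝ) :
    adjacencyForm f g
      ≤ b * (s - 1) * (((31 / 32 * ∑ x, f x ^ 2 + 1 / 32 * ((∑ x, f x) ^ 2 / s ^ b))
        + (31 / 32 * ∑ x, g x ^ 2 + 1 / 32 * ((∑ x, g x) ^ 2 / s ^ b))) / 2) := by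
  have h1 := (abs_le.1 (abs_adjacencyForm_le hs hb1 hb fun x => f x + g x)).2
  have h2 := (abs_le.1 (abs_adjacencyForm_le hs hb1 hb fun x => f x - g x)).1
  have h3 := adjacencyForm_polarization f g
  have e1 : ∑ x, (f x + g x) ^ 2 + ∑ x, (f x - g x) ^ 2 = 2 * ∑ x, f x ^ 2 + 2 * ∑ x, g x ^ 2 := by
    simp only [mul_sum, ← sum_add_distrib]
    exact sum_congr rfl fun x _ => by ring
  rw [sum_add_distrib] at h1
  rw [sum_sub_distrib] at h2
  have e1' : ∑ x, (f x + g x) ^ 2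
      = 2 * ∑ x, f x ^ 2 + 2 * ∑ x, g x ^ 2 - ∑ x, (f x - g x) ^ 2 := by linarith
  rw [e1'] at h1
  have h4 : 4 * adjacencyForm f g ≤ 4 * (b * (s - 1) *
      (((31 / 32 * ∑ x, f x ^ 2 + 1 / 32 * ((∑ x, f x) ^ 2 / s ^ b))
        + (31 / 32 * ∑ x, g x ^ 2 + 1 / 32 * ((∑ x, g x) ^ 2 / s ^ b))) / 2)) := by
    rw [h3]
    refine (sub_le_sub h1 h2).trans_eq ?_
    ring
  linarith

lemma eq_zero_of_rpow_sum_eq_zero {Ω : Type*} [Fintype Ω] {p : ℝ} (hp : 0 < p) {f : Ω → ℝ}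
    (hf : ∀ x, 0 ≤ f x) (h : (∑ x, f x ^ p) ^ (1 / p) = 0) (x : Ω) : f x = 0 := by
  have h0 : ∀ x ∈ univ, 0 ≤ f x ^ p := fun x _ => Real.rpow_nonneg (hf x) _
  rw [Real.rpow_eq_zero (sum_nonneg h0) (by positivity)] at h
  exact (Real.rpow_eq_zero (hf x) hp.ne').1 ((sum_eq_zero_iff_of_nonneg h0).1 h x (mem_univ x))

lemma sum_rpow_div_norm {Ω : Type*} [Fintype Ω] {p : ℝ} (hp : 0 < p) {f : Ω → ℝ}
    (hf : ∀ x, 0 ≤ f x) (h : (∑ x, f x ^ p) ^ (1 / p) ≠ 0) :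
    ∑ x, (f x / (∑ y, f y ^ p) ^ (1 / p)) ^ p = 1 := by
  have h0 : 0 ≤ ∑ x, f x ^ p := sum_nonneg fun x _ => Real.rpow_nonneg (hf x) _
  simp_rw [Real.div_rpow (hf _) (Real.rpow_nonneg h0 _), ← sum_div]
  rw [← Real.rpow_mul h0, one_div_mul_cancel hp.ne', Real.rpow_one]
  refine div_self fun h' => h ?_
  rw [h', Real.zero_rpow (by positivity)]

/-- Two-function hypercontractivity for the kernel resampling one coordinate of a short block. -/
lemma adjacencyForm_le_rpow {b s : ℕ} [NeZero s] (hs : 3 ≤ s) (hb1 : 1 ≤ b) (hb : b ≤ 32) {p : ℝ}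
    (hp1 : 1 < p) (hp2 : p ≤ 2) (hp : 31 / 32 ≤ (p - 1) * ((s : ℝ) ^ b) ^ (p - 2))
    (f g : (Fin b → ZMod s) → ℝ) (hf : ∀ x, 0 ≤ f x) (hg : ∀ x, 0 ≤ g x) :
    adjacencyForm f g ≤ b * (s - 1) * ((s : ℝ) ^ b) ^ (1 - 2 / p)
      * ((∑ x, f x ^ p) ^ (1 / p) * (∑ x, g x ^ p) ^ (1 / p)) := by
  have hp0 : 0 < p := by linarith
  have hs' : (3 : ℝ) ≤ s := by exact_mod_cast hs
  have hN0 : (0 : ℝ) < (s : ℝ) ^ b := by positivity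
  have hcard : (Fintype.card (Fin b → ZMod s) : ℝ) = (s : ℝ) ^ b := by simp [ZMod.card]
  have unit : ∀ h : (Fin b → ZMod s) → ℝ, (∀ x, 0 ≤ h x) → ∑ x, h x ^ p = 1 →
      31 / 32 * ∑ x, h x ^ 2 + 1 / 32 * ((∑ x, h x) ^ 2 / s ^ b)
        ≤ ((s : ℝ) ^ b) ^ (1 - 2 / p) := by
    intro h hh h1
    have hΩ : 1 < Fintype.card (Fin b → ZMod s) := by
      simp only [Fintype.card_fun, ZMod.card, Fintype.card_fin]
      exact Nat.one_lt_pow (by omega) (by omega)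
    have := mean_sq_le_mean_rpow hΩ hp1 hp2 (ρ := 31 / 32) (by rwa [hcard]) h hh
    rw [h1, hcard, one_div, Real.inv_rpow hN0.le, ← Real.rpow_neg hN0.le] at this
    have h2 := mul_le_mul_of_nonneg_left this hN0.le
    rw [sub_eq_add_neg, Real.rpow_add hN0, Real.rpow_one]
    refine le_trans (le_of_eq ?_) h2
    field_simp
    ring
  set F := (∑ x, f x ^ p) ^ (1 / p) with hF
  set G := (∑ x, g x ^ p) ^ (1 / p) with hG
  by_cases hF0 : F = 0
  · have := eq_zero_of_rpow_sum_eq_zero hp0 hf hF0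
    simp [adjacencyForm, this, hF0]
  by_cases hG0 : G = 0
  · have := eq_zero_of_rpow_sum_eq_zero hp0 hg hG0
    simp [adjacencyForm, this, hG0]
  have hFp : 0 < F := lt_of_le_of_ne
    (Real.rpow_nonneg (sum_nonneg fun x _ => Real.rpow_nonneg (hf x) _) _) (Ne.symm hF0)
  have hGp : 0 < G := lt_of_le_of_ne
    (Real.rpow_nonneg (sum_nonneg fun x _ => Real.rpow_nonneg (hg x) _) _) (Ne.symm hG0)
  have u1 := unit (fun x => f x / F) (fun x => div_nonneg (hf x) hFp.le)
    (sum_rpow_div_norm hp0 hf hF0)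
  have u2 := unit (fun x => g x / G) (fun x => div_nonneg (hg x) hGp.le)
    (sum_rpow_div_norm hp0 hg hG0)
  have h1 := adjacencyForm_le_mean hs hb1 hb (fun x => f x / F) (fun x => g x / G)
  have h2 : adjacencyForm f g = adjacencyForm (fun x => f x / F) (fun x => g x / G) * (F * G) := by
    simp only [adjacencyForm, sum_mul]
    refine sum_congr rfl fun x _ => sum_congr rfl fun y _ => ?_
    split_ifs
    · field_simp
    · simp
  rw [h2]
  refine mul_le_mul_of_nonneg_right (h1.trans ?_) (by positivity)
  refine mul_le_mul_of_nonneg_left (by linarith) (mul_nonneg (by positivity) (by linarith))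

/-- Two-function `L^p` bounds for nonnegative kernels tensorize. -/
lemma tensor_kernel_le {p : ℝ} (hp : 0 < p) {m : ℕ} (Ω : Fin m → Type*) [∀ j, Fintype (Ω j)]
    (k : ∀ j, Ω j → Ω j → ℝ) (hk : ∀ j x y, 0 ≤ k j x y) (c : Fin m → ℝ) (hc : ∀ j, 0 ≤ c j)
    (h : ∀ j, ∀ f g : Ω j → ℝ, (∀ x, 0 ≤ f x) → (∀ x, 0 ≤ g x) →
      ∑ x, ∑ y, k j x y * (f x * g y)
        ≤ c j * ((∑ x, f x ^ p) ^ (1 / p) * (∑ x, g x ^ p) ^ (1 / p)))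
    (f g : (∀ j, Ω j) → ℝ) (hf : ∀ x, 0 ≤ f x) (hg : ∀ x, 0 ≤ g x) :
    ∑ x, ∑ y, (∏ j, k j (x j) (y j)) * (f x * g y)
      ≤ (∏ j, c j) * ((∑ x, f x ^ p) ^ (1 / p) * (∑ x, g x ^ p) ^ (1 / p)) := by
  induction m with
  | zero =>
    simp only [univ_unique, sum_singleton, prod_of_isEmpty, one_mul]
    rw [← Real.rpow_mul (hf _), ← Real.rpow_mul (hg _), mul_one_div_cancel hp.ne', Real.rpow_one,
      Real.rpow_one]
  | succ m ih =>
    have split : ∀ F : (∀ j, Ω j) → ℝ, ∑ x, F x = ∑ a, ∑ x, F (Fin.cons a x) := fun F => by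
      rw [← (Fin.consEquiv Ω).sum_comp, Fintype.sum_prod_type]
      rfl
    have pos : ∀ F : (∀ j, Ω j) → ℝ, (∀ x, 0 ≤ F x) → ∀ a, 0 ≤ ∑ x, F (Fin.cons a x) ^ p :=
      fun F hF a => sum_nonneg fun x _ => Real.rpow_nonneg (hF _) _
    have norm : ∀ F : (∀ j, Ω j) → ℝ, (∀ x, 0 ≤ F x) →
        ∑ a, ((∑ x, F (Fin.cons a x) ^ p) ^ (1 / p)) ^ p = ∑ x, F x ^ p := by
      intro F hF
      rw [split fun x => F x ^ p]
      refine sum_congr rfl fun a _ => ?_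
      rw [← Real.rpow_mul (pos F hF a), one_div_mul_cancel hp.ne', Real.rpow_one]
    calc ∑ x, ∑ y, (∏ j, k j (x j) (y j)) * (f x * g y)
        = ∑ a, ∑ c, k 0 a c * ∑ x, ∑ y, (∏ j : Fin m, k j.succ (x j) (y j))
            * (f (Fin.cons a x) * g (Fin.cons c y)) := by
          rw [split]
          simp_rw [fun x => split (fun y => (∏ j, k j (x j) (y j)) * (f x * g y)),
            Fin.prod_univ_succ, Fin.cons_zero, Fin.cons_succ, mul_sum]
          refine sum_congr rfl fun a _ => ?_
          rw [sum_comm]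
          refine sum_congr rfl fun c _ => sum_congr rfl fun x _ => sum_congr rfl fun y _ => ?_
          ring
      _ ≤ ∑ a, ∑ d, k 0 a d * ((∏ j : Fin m, c j.succ)
            * ((∑ x, f (Fin.cons a x) ^ p) ^ (1 / p) * (∑ x, g (Fin.cons d x) ^ p) ^ (1 / p))) := by
          refine sum_le_sum fun a _ => sum_le_sum fun d _ => ?_
          refine mul_le_mul_of_nonneg_left ?_ (hk 0 a d)
          exact ih (fun j => Ω j.succ) (fun j => k j.succ) (fun j => hk j.succ)
            (fun j => c j.succ) (fun j => hc j.succ) (fun j => h j.succ)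
            (fun x => f (Fin.cons a x)) (fun x => g (Fin.cons d x)) (fun _ => hf _) fun _ => hg _
      _ = (∏ j : Fin m, c j.succ) * ∑ a, ∑ d, k 0 a d
            * ((∑ x, f (Fin.cons a x) ^ p) ^ (1 / p) * (∑ x, g (Fin.cons d x) ^ p) ^ (1 / p)) := by
          simp_rw [mul_sum]
          refine sum_congr rfl fun a _ => sum_congr rfl fun d _ => ?_
          ring
      _ ≤ (∏ j : Fin m, c j.succ) * (c 0 * ((∑ x, f x ^ p) ^ (1 / p)
            * (∑ x, g x ^ p) ^ (1 / p))) := by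
          refine mul_le_mul_of_nonneg_left ?_ (prod_nonneg fun j _ => hc _)
          have := h 0 (fun a => (∑ x, f (Fin.cons a x) ^ p) ^ (1 / p))
            (fun a => (∑ x, g (Fin.cons a x) ^ p) ^ (1 / p))
            (fun a => Real.rpow_nonneg (pos f hf a) _) fun a => Real.rpow_nonneg (pos g hg a) _
          rwa [norm f hf, norm g hg] at this
      _ = _ := by
          rw [Fin.prod_univ_succ]
          ring

/-- The image under `σ` of each block `Fin (b j)` meets `D` in exactly one point. -/
def IsTransversal {n m : ℕ} {b : Fin m → ℕ} (σ : (Σ j, Fin (b j)) ≃ Fin n)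
    (D : Finset (Fin n)) : Prop :=
  ∀ j, #{i | σ ⟨j, i⟩ ∈ D} = 1

instance {n m : ℕ} {b : Fin m → ℕ} (σ : (Σ j, Fin (b j)) ≃ Fin n) (D : Finset (Fin n)) :
    Decidable (IsTransversal σ D) :=
  inferInstanceAs (Decidable (∀ j, #{i | σ ⟨j, i⟩ ∈ D} = 1))

lemma card_isTransversal_congr {n m : ℕ} {b : Fin m → ℕ} {D D' : Finset (Fin n)}
    (h : #D = #D') :
    #{σ : (Σ j, Fin (b j)) ≃ Fin n | IsTransversal σ D}
      = #{σ : (Σ j, Fin (b j)) ≃ Fin n | IsTransversal σ D'} := by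
  let π : Equiv.Perm (Fin n) := (Finset.equivOfCardEq h).extendSubtype
  have hπ : ∀ i, π i ∈ D' ↔ i ∈ D := fun i =>
    ⟨fun hi => by_contra fun hn => (Finset.equivOfCardEq h).extendSubtype_not_mem i hn hi,
      fun hi => (Finset.equivOfCardEq h).extendSubtype_mem i hi⟩
  refine card_equiv (Equiv.equivCongr (Equiv.refl _) π) fun σ => ?_
  simp only [mem_filter, mem_univ, true_and]
  simp [IsTransversal, hπ]

lemma prod_le_card_transversals {n m : ℕ} {b : Fin m → ℕ} (σ : (Σ j, Fin (b j)) ≃ Fin n) :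
    ∏ j, b j ≤ #{D ∈ powersetCard m (univ : Finset (Fin n)) | IsTransversal σ D} := by
  have hmem : ∀ (c : ∀ j, Fin (b j)) j i,
      σ ⟨j, i⟩ ∈ univ.image (fun j => σ ⟨j, c j⟩) ↔ i = c j := by
    intro c j i
    simp only [mem_image, mem_univ, true_and, EmbeddingLike.apply_eq_iff_eq]
    constructor
    · rintro ⟨j', h⟩
      obtain ⟨rfl, h⟩ := Sigma.mk.inj_iff.1 h
      exact (eq_of_heq h).symm
    · rintro rfl
      exact ⟨j, rfl⟩
  have hcard : ∏ j, b j = #(univ : Finset (∀ j, Fin (b j))) := by simp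
  rw [hcard]
  refine card_le_card_of_injOn (fun c => univ.image fun j => σ ⟨j, c j⟩) ?_ ?_
  · intro c _
    simp only [coe_filter, Set.mem_ofPred_eq, mem_powersetCard, subset_univ, true_and]
    constructor
    · rw [card_image_of_injective, card_univ, Fintype.card_fin]
      intro j j' h
      exact (Sigma.mk.inj_iff.1 (σ.injective h)).1
    · intro j
      refine card_eq_one.2 ⟨c j, ?_⟩
      ext i
      rw [mem_filter, mem_singleton]
      exact ⟨fun h => (hmem c j i).1 h.2, fun h => ⟨mem_univ i, (hmem c j i).2 h⟩⟩
  · intro c _ c' _ h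
    funext j
    have h1 := (hmem c j (c j)).2 rfl
    rw [show univ.image (fun j => σ ⟨j, c j⟩) = univ.image (fun j => σ ⟨j, c' j⟩) from h] at h1
    exact (hmem c' j (c j)).1 h1

lemma factorial_mul_prod_le {n m : ℕ} {b : Fin m → ℕ} (hb : ∑ j, b j = n) {D : Finset (Fin n)}
    (hD : #D = m) :
    n.factorial * ∏ j, b j
      ≤ n.choose m * #{σ : (Σ j, Fin (b j)) ≃ Fin n | IsTransversal σ D} := by
  have e : (Σ j, Fin (b j)) ≃ Fin n := finSigmaFinEquiv.trans (finCongr hb)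
  have hcard : Fintype.card ((Σ j, Fin (b j)) ≃ Fin n) = n.factorial := by
    rw [Fintype.card_equiv e, Fintype.card_congr e, Fintype.card_fin]
  calc n.factorial * ∏ j, b j
      = ∑ _σ : (Σ j, Fin (b j)) ≃ Fin n, ∏ j, b j := by
        rw [sum_const, card_univ, hcard, smul_eq_mul]
    _ ≤ ∑ σ : (Σ j, Fin (b j)) ≃ Fin n,
          #{D ∈ powersetCard m (univ : Finset (Fin n)) | IsTransversal σ D} :=
        sum_le_sum fun σ _ => prod_le_card_transversals σ
    _ = ∑ D' ∈ powersetCard m (univ : Finset (Fin n)),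
          #{σ : (Σ j, Fin (b j)) ≃ Fin n | IsTransversal σ D'} := by
        simp_rw [card_filter]
        rw [sum_comm]
    _ = ∑ _D' ∈ powersetCard m (univ : Finset (Fin n)),
          #{σ : (Σ j, Fin (b j)) ≃ Fin n | IsTransversal σ D} :=
        sum_congr rfl fun D' hD' =>
          card_isTransversal_congr ((mem_powersetCard.1 hD').2.trans hD.symm)
    _ = _ := by
        rw [sum_const, card_powersetCard, card_univ, Fintype.card_fin, smul_eq_mul]

lemma card_pairs_isTransversal_le {n m s : ℕ} [NeZero s] (hs : 3 ≤ s) {b : Fin m → ℕ}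
    (hb1 : ∀ j, 1 ≤ b j) (hb : ∀ j, b j ≤ 32) (hbn : ∑ j, b j = n) {p : ℝ} (hp1 : 1 < p)
    (hp2 : p ≤ 2) (hp : 31 / 32 ≤ (p - 1) * ((s : ℝ) ^ 32) ^ (p - 2))
    (A : Finset (Fin n → ZMod s)) (σ : (Σ j, Fin (b j)) ≃ Fin n) :
    (#{q ∈ A ×ˢ A | IsTransversal σ {i | q.1 i ≠ q.2 i}} : ℝ)
      ≤ (∏ j, (b j : ℝ)) * (s - 1) ^ m * ((s : ℝ) ^ n) ^ (1 - 2 / p) * (#A : ℝ) ^ (2 / p) := by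
  have hs' : (3 : ℝ) ≤ s := by exact_mod_cast hs
  have hp0 : 0 < p := by linarith
  let E : (Fin n → ZMod s) ≃ (∀ j, Fin (b j) → ZMod s) :=
    (Equiv.arrowCongr σ.symm (Equiv.refl _)).trans (Equiv.piCurry fun _ _ => ZMod s)
  have hE : ∀ x j i, E x j i = x (σ ⟨j, i⟩) := fun x j i => rfl
  let f : (∀ j, Fin (b j) → ZMod s) → ℝ := fun z => if E.symm z ∈ A then 1 else 0
  have hf : ∀ z, 0 ≤ f z := fun z => by simp only [f]; split_ifs <;> norm_num
  have hfp : ∑ z, f z ^ p = #A := by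
    rw [← E.sum_comp]
    have : ∀ x, f (E x) ^ p = if x ∈ A then 1 else 0 := fun x => by
      simp only [f, Equiv.symm_apply_apply]
      split_ifs <;> simp [hp0.ne']
    simp [this]
  have hker := tensor_kernel_le hp0 (fun j => Fin (b j) → ZMod s)
    (fun j x y => if hammingDist x y = 1 then 1 else 0)
    (fun j x y => by split_ifs <;> norm_num)
    (fun j => b j * (s - 1) * ((s : ℝ) ^ b j) ^ (1 - 2 / p))
    (fun j => mul_nonneg (mul_nonneg (by positivity) (by linarith)) (by positivity))
    (fun j f g hf hg => by
      have hp' : 31 / 32 ≤ (p - 1) * ((s : ℝ) ^ b j) ^ (p - 2) := by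
        refine hp.trans (mul_le_mul_of_nonneg_left ?_ (by linarith))
        exact Real.rpow_le_rpow_of_nonpos (by positivity)
          (pow_le_pow_right₀ (by linarith) (hb j)) (by linarith)
      simpa [adjacencyForm] using adjacencyForm_le_rpow hs (hb1 j) (hb j) hp1 hp2 hp' f g hf hg)
    f f hf hf
  have hcount : (#{q ∈ A ×ˢ A | IsTransversal σ {i | q.1 i ≠ q.2 i}} : ℝ)
      = ∑ x, ∑ y, (∏ j, if hammingDist (x j) (y j) = 1 then (1 : ℝ) else 0) * (f x * f y) := by
    rw [← E.sum_comp]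
    simp_rw [fun x => (E.sum_comp (fun y =>
      (∏ j, if hammingDist (E x j) (y j) = 1 then (1 : ℝ) else 0) * (f (E x) * f y))).symm]
    rw [card_filter, sum_product, ← sum_subset (subset_univ A)]
    · push_cast
      refine sum_congr rfl fun x hx => ?_
      rw [← sum_subset (subset_univ A)]
      · refine sum_congr rfl fun y hy => ?_
        simp only [f, Equiv.symm_apply_apply, hx, hy, if_true, mul_one]
        rw [prod_ite_zero]
        simp [IsTransversal, hammingDist, hE]
      · intro y _ hy
        simp [f, hy]
    · intro x _ hx
      simp [f, hx]
  have hA0 : (0 : ℝ) ≤ #A := by positivity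
  rw [hcount]
  refine hker.trans_eq ?_
  rw [hfp, ← Real.rpow_add_of_nonneg hA0 (by positivity) (by positivity), prod_mul_distrib,
    prod_mul_distrib, prod_const, card_univ, Fintype.card_fin,
    Real.finsetProd_rpow _ _ fun _ _ => by positivity, prod_pow_eq_pow_sum, hbn]
  congr 2
  ring

lemma exists_block_sizes {n m k : ℕ} (h1 : m ≤ n) (h2 : n ≤ k * m) :
    ∃ b : Fin m → ℕ, (∀ j, 1 ≤ b j) ∧ (∀ j, b j ≤ k) ∧ ∑ j, b j = n := by
  induction m generalizing n with
  | zero => exact ⟨fun _ => 1, by simp, by simp, by simp at h2; simp [h2]⟩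
  | succ m ih =>
    have hk : 1 ≤ k := by
      by_contra hk
      obtain rfl : k = 0 := by omega
      omega
    rw [mul_add_one] at h2
    have h3 : m ≤ k * m := Nat.le_mul_of_pos_left m hk
    obtain ⟨b, hb1, hbk, hb⟩ := ih (n := n - min k (n - m)) (by omega) (by omega)
    refine ⟨Fin.cons (min k (n - m)) b, fun j => ?_, fun j => ?_, ?_⟩
    · cases j using Fin.cases with
      | zero => simp only [Fin.cons_zero]; omega
      | succ j => exact hb1 j
    · cases j using Fin.cases with
      | zero => simp only [Fin.cons_zero]; omega
      | succ j => exact hbk j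
    · rw [Fin.sum_univ_succ]
      simp only [Fin.cons_zero, Fin.cons_succ, hb]
      omega

lemma card_pairs_hammingDist_le {n m s : ℕ} [NeZero s] (hs : 3 ≤ s) (hm1 : m ≤ n)
    (hm2 : n ≤ 32 * m) {p : ℝ} (hp1 : 1 < p) (hp2 : p ≤ 2)
    (hp : 31 / 32 ≤ (p - 1) * ((s : ℝ) ^ 32) ^ (p - 2)) (A : Finset (Fin n → ZMod s)) :
    (#{q ∈ A ×ˢ A | hammingDist q.1 q.2 = m} : ℝ)
      ≤ n.choose m * (s - 1) ^ m * ((s : ℝ) ^ n) ^ (1 - 2 / p) * (#A : ℝ) ^ (2 / p) := by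
  obtain ⟨b, hb1, hb, hbn⟩ := exists_block_sizes hm1 hm2
  set S := A ×ˢ A with hS
  have e : (Σ j, Fin (b j)) ≃ Fin n := finSigmaFinEquiv.trans (finCongr hbn)
  have hcard : Fintype.card ((Σ j, Fin (b j)) ≃ Fin n) = n.factorial := by
    rw [Fintype.card_equiv e, Fintype.card_congr e, Fintype.card_fin]
  have hlow : #{q ∈ S | hammingDist q.1 q.2 = m} * (n.factorial * ∏ j, b j)
      ≤ n.choose m * ∑ σ : (Σ j, Fin (b j)) ≃ Fin n,
        #{q ∈ S | IsTransversal σ {i | q.1 i ≠ q.2 i}} := by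
    calc #{q ∈ S | hammingDist q.1 q.2 = m} * (n.factorial * ∏ j, b j)
        ≤ ∑ q ∈ S with hammingDist q.1 q.2 = m, n.choose m
            * #{σ : (Σ j, Fin (b j)) ≃ Fin n | IsTransversal σ {i | q.1 i ≠ q.2 i}} := by
          rw [← smul_eq_mul, ← sum_const]
          exact sum_le_sum fun q hq => factorial_mul_prod_le hbn (mem_filter.1 hq).2
      _ ≤ ∑ q ∈ S, n.choose m
            * #{σ : (Σ j, Fin (b j)) ≃ Fin n | IsTransversal σ {i | q.1 i ≠ q.2 i}} :=
          sum_le_sum_of_subset (filter_subset _ _)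
      _ = _ := by
          rw [← mul_sum]
          simp_rw [card_filter]
          rw [sum_comm]
  have hup := sum_le_sum fun σ (_ : σ ∈ (univ : Finset ((Σ j, Fin (b j)) ≃ Fin n))) =>
    card_pairs_isTransversal_le hs hb1 hb hbn hp1 hp2 hp A σ
  rw [sum_const, card_univ, hcard, nsmul_eq_mul] at hup
  have hlow' : (#{q ∈ S | hammingDist q.1 q.2 = m} : ℝ) * (n.factorial * ∏ j, (b j : ℝ))
      ≤ n.choose m * ∑ σ : (Σ j, Fin (b j)) ≃ Fin n,
        (#{q ∈ S | IsTransversal σ {i | q.1 i ≠ q.2 i}} : ℝ) := by exact_mod_cast hlow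
  have hpos : (0 : ℝ) < n.factorial * ∏ j, (b j : ℝ) :=
    mul_pos (by positivity) (prod_pos fun j _ => by exact_mod_cast hb1 j)
  refine le_of_mul_le_mul_right (hlow'.trans ?_) hpos
  refine (mul_le_mul_of_nonneg_left hup (by positivity)).trans_eq ?_
  ring

theorem stmt14 {s n m : ℕ} (hs : 3 ≤ s) [NeZero s] (hn : 1 ≤ n)
    (hm1 : (n : ℝ) / 32 ≤ m) (hm2 : m ≤ n)
    (A : Finset (Fin n → ZMod s)) (δ : ℝ) (hδ : δ = (A.card : ℝ) / s ^ n) :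
    ((Finset.univ.filter (fun p : (Fin n → ZMod s) × (Fin n → ZMod s) =>
        p.1 ∈ A ∧ p.2 ∈ A ∧ hammingDist p.1 p.2 = m)).card : ℝ)
      / ((s : ℝ) ^ n * (n.choose m * ((s : ℝ) - 1) ^ m))
      ≤ 2 * δ ^ ((1 : ℝ) + 1 / (2 ^ 14 * Real.logb 2 s)) := by
  have hs' : (3 : ℝ) ≤ s := by exact_mod_cast hs
  have hs0 : (0 : ℝ) < s := by linarith
  have hm3 : n ≤ 32 * m := by
    have : (n : ℝ) ≤ 32 * m := by linarith
    exact_mod_cast this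
  have hL : 1 ≤ Real.logb 2 s := by
    rw [Real.le_logb_iff_rpow_le one_lt_two hs0]
    norm_num
    linarith
  have hsL : (s : ℝ) = 2 ^ Real.logb 2 s := (Real.rpow_logb two_pos (by norm_num) hs0).symm
  set L := Real.logb 2 s
  set lam := 1 / (2 ^ 14 * L) with hlam
  have hlam0 : 0 < lam := by positivity
  have hlamL : lam * L = 1 / 2 ^ 14 := by rw [hlam]; field_simp
  have hlam1 : lam ≤ 1 / 2 ^ 14 := by nlinarith
  set p := 2 / (1 + lam) with hpdef
  have h2p : 2 / p = 1 + lam := by rw [hpdef]; field_simp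
  have hp2 : p ≤ 2 := by rw [hpdef, div_le_iff₀ (by positivity)]; linarith
  have hpl : 2 - 2 * lam ≤ p := by
    rw [hpdef, le_div_iff₀ (by positivity)]
    nlinarith
  have hp1 : 1 < p := by norm_num at hlam1; linarith
  have hpow : 1 - 1 / 2 ^ 8 ≤ ((s : ℝ) ^ 32) ^ (p - 2) := by
    have h1 : ((s : ℝ) ^ 32) ^ (p - 2) = 2 ^ (-(32 * L * (2 - p))) := by
      rw [hsL, ← Real.rpow_natCast, ← Real.rpow_mul (by positivity), ← Real.rpow_mul (by norm_num)]
      congr 1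
      push_cast
      ring
    have h2 : (2 : ℝ) ^ (-(1 / 2 ^ 8 : ℝ)) ≤ 2 ^ (-(32 * L * (2 - p))) := by
      refine Real.rpow_le_rpow_of_exponent_le one_le_two (neg_le_neg ?_)
      have : L * (2 - p) ≤ L * (2 * lam) := mul_le_mul_of_nonneg_left (by linarith) (by linarith)
      norm_num at hlamL ⊢
      linarith
    have h3 : 1 - 1 / 2 ^ 8 ≤ (2 : ℝ) ^ (-(1 / 2 ^ 8 : ℝ)) := by
      rw [Real.rpow_def_of_pos two_pos]
      have := Real.add_one_le_exp (Real.log 2 * -(1 / 2 ^ 8))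
      have h4 := Real.log_two_lt_d9
      norm_num at this ⊢
      linarith
    rw [h1]
    exact h3.trans h2
  have hp : 31 / 32 ≤ (p - 1) * ((s : ℝ) ^ 32) ^ (p - 2) := by
    have h1 : (1 - 1 / 2 ^ 13 : ℝ) ≤ p - 1 := by norm_num at hlam1 ⊢; linarith
    refine le_trans ?_ (mul_le_mul h1 hpow (by norm_num) (by linarith))
    norm_num
  have hmain := card_pairs_hammingDist_le hs hm2 hm3 hp1 hp2 hp A
  have hset : (Finset.univ.filter (fun p : (Fin n → ZMod s) × (Fin n → ZMod s) =>
        p.1 ∈ A ∧ p.2 ∈ A ∧ hammingDist p.1 p.2 = m))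
      = {q ∈ A ×ˢ A | hammingDist q.1 q.2 = m} := by
    ext q
    simp [and_assoc]
  have hch : (0 : ℝ) < n.choose m := by exact_mod_cast Nat.choose_pos hm2
  have hs1 : (0 : ℝ) < (s : ℝ) - 1 := by linarith
  have hN : (0 : ℝ) < (s : ℝ) ^ n := by positivity
  have hδ0 : 0 ≤ δ := hδ ▸ div_nonneg (Nat.cast_nonneg _) hN.le
  rw [hset]
  have hle : (#{q ∈ A ×ˢ A | hammingDist q.1 q.2 = m} : ℝ)
      / ((s : ℝ) ^ n * (n.choose m * ((s : ℝ) - 1) ^ m)) ≤ δ ^ (1 + lam) := by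
    rw [div_le_iff₀ (by positivity)]
    refine hmain.trans_eq ?_
    rw [h2p, hδ, Real.div_rpow (Nat.cast_nonneg _) hN.le, Real.rpow_sub hN, Real.rpow_one]
    ring
  linarith [Real.rpow_nonneg hδ0 (1 + lam)]
end

section
/- Let s ≥ 2, n ≥ 1, A ⊆ (ZMod s)^n with density δ = |A|/s^n, let q ≥ 2 be a real number, let ρ be a real number with 0 ≤ ρ ≤ (1/(q−1))·(1/s)^{1−2/q}, and set ν = (1−1/s)(1−ρ). Let x be uniformly random on (ZMod s)^n and y = x + μ where μ ∈ (ZMod s)^n has independent coordinates, each equal to 0 with probability 1−ν and equal to each nonzero element of ZMod s with probability ν/(s−1). Then Pr[x ∈ A and y ∈ A] ≤ δ^{2−2/q}. -/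
open Finset

section Hypercontractivity

variable {p : ℝ}

lemma rpow_sub_rpow_mul_sub_ge (hp1 : 1 < p) (hp2 : p ≤ 2) {u v M : ℝ} (hu : 0 < u) (hv : 0 < v)
    (huM : u ≤ M) (hvM : v ≤ M) :
    (p - 1) * M ^ (p - 2) * (u - v) ^ 2 ≤ (u ^ (p - 1) - v ^ (p - 1)) * (u - v) := by
  wlog h : v ≤ u generalizing u v
  · have := this hv hu hvM huM (le_of_not_ge h)
    nlinarith
  have hbern : (v / u) ^ (p - 1) ≤ 1 + (p - 1) * (v / u - 1) := by
    have := rpow_one_add_le_one_add_mul_self (s := v / u - 1) (p := p - 1)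
      (by have := div_pos hv hu; linarith) (by linarith) (by linarith)
    simpa using this
  have hM : M ^ (p - 2) ≤ u ^ (p - 2) :=
    Real.rpow_le_rpow_of_nonpos hu huM (by linarith)
  have hv' : v ^ (p - 1) = u ^ (p - 1) * (v / u) ^ (p - 1) := by
    rw [← Real.mul_rpow hu.le (by positivity), mul_div_cancel₀ _ hu.ne']
  have hu' : u ^ (p - 1) = u ^ (p - 2) * u := by
    rw [← Real.rpow_add_one hu.ne']; ring_nf
  have key : (p - 1) * u ^ (p - 2) * (u - v) ≤ u ^ (p - 1) - v ^ (p - 1) := by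
    have h1 := mul_le_mul_of_nonneg_left hbern (Real.rpow_nonneg hu.le (p - 1))
    have h2 : u ^ (p - 1) * (1 + (p - 1) * (v / u - 1)) =
        u ^ (p - 1) - (p - 1) * u ^ (p - 2) * (u - v) := by
      rw [hu']; field_simp; ring
    rw [← hv', h2] at h1
    linarith
  have huv : 0 ≤ u - v := sub_nonneg.2 h
  calc (p - 1) * M ^ (p - 2) * (u - v) ^ 2
      ≤ (p - 1) * u ^ (p - 2) * (u - v) ^ 2 := by
        gcongr
    _ = (p - 1) * u ^ (p - 2) * (u - v) * (u - v) := by ring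
    _ ≤ _ := by gcongr

variable {ι : Type*} [Fintype ι]

lemma le_sum_rpow_rpow_inv (hp : 0 < p) {f : ι → ℝ} (hf : ∀ i, 0 ≤ f i) (i : ι) :
    f i ≤ (∑ j, f j ^ p) ^ p⁻¹ := by
  rw [Real.le_rpow_inv_iff_of_pos (hf i) (sum_nonneg fun j _ => Real.rpow_nonneg (hf j) p) hp]
  exact single_le_sum (f := fun j => f j ^ p) (fun j _ => Real.rpow_nonneg (hf j) p) (mem_univ i)

lemma two_uniform_convexity_deriv [Nonempty ι] (hp1 : 1 < p) (hp2 : p ≤ 2) {a t : ℝ} (ha : 0 < a)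
    {d : ι → ℝ} (hd : ∑ i, d i = 0) (ht : 0 < t) (hpos : ∀ i, 0 < a + t * d i) :
    (p - 1) * t * ∑ i, d i ^ 2 ≤
      (∑ i, (a + t * d i) ^ p) ^ (2 / p - 1) * ∑ i, (a + t * d i) ^ (p - 1) * d i := by
  set N := ∑ i, (a + t * d i) ^ p with hN
  have hN0 : 0 < N := sum_pos (fun i _ => Real.rpow_pos_of_pos (hpos i) p) univ_nonempty
  have hfM (i : ι) : a + t * d i ≤ N ^ p⁻¹ :=
    le_sum_rpow_rpow_inv (by linarith) (fun j => (hpos j).le) i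
  have haM : a ≤ N ^ p⁻¹ := by
    obtain ⟨i, -, hi⟩ : ∃ i ∈ (univ : Finset ι), (0 : ℝ) ≤ d i :=
      exists_le_of_sum_le univ_nonempty (by simp [hd])
    exact le_trans (by nlinarith) (hfM i)
  have hsum : ∑ i, (a + t * d i) ^ (p - 1) * d i =
      ∑ i, ((a + t * d i) ^ (p - 1) - a ^ (p - 1)) * d i := by
    simp only [sub_mul, sum_sub_distrib, ← mul_sum, hd, mul_zero, sub_zero]
  have hexp : N ^ (2 / p - 1) * (N ^ p⁻¹) ^ (p - 2) = 1 := by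
    rw [← Real.rpow_mul hN0.le, ← Real.rpow_add hN0]
    have : 2 / p - 1 + p⁻¹ * (p - 2) = 0 := by
      have : p ≠ 0 := by linarith
      field_simp; ring
    rw [this, Real.rpow_zero]
  rw [hsum, mul_sum, mul_sum]
  refine sum_le_sum fun i _ => ?_
  have h := rpow_sub_rpow_mul_sub_ge hp1 hp2 (hpos i) ha (hfM i) haM
  have h' : (p - 1) * (N ^ p⁻¹) ^ (p - 2) * t * d i ^ 2 ≤
      ((a + t * d i) ^ (p - 1) - a ^ (p - 1)) * d i := by
    refine le_of_mul_le_mul_left ?_ ht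
    calc _ = (p - 1) * (N ^ p⁻¹) ^ (p - 2) * (a + t * d i - a) ^ 2 := by ring
      _ ≤ _ := h
      _ = _ := by ring
  calc (p - 1) * t * d i ^ 2
      = N ^ (2 / p - 1) * (N ^ p⁻¹) ^ (p - 2) * ((p - 1) * t * d i ^ 2) := by rw [hexp, one_mul]
    _ = N ^ (2 / p - 1) * ((p - 1) * (N ^ p⁻¹) ^ (p - 2) * t * d i ^ 2) := by ring
    _ ≤ _ := by gcongr

lemma two_uniform_convexity_of_sum_eq_zero [Nonempty ι] (hp1 : 1 < p) (hp2 : p ≤ 2) {a : ℝ}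
    (ha : 0 < a) {d : ι → ℝ} (hd : ∑ i, d i = 0) (hpos : ∀ i, 0 ≤ a + d i) :
    (Fintype.card ι : ℝ) ^ (2 / p) * a ^ 2 + (p - 1) * ∑ i, d i ^ 2 ≤
      (∑ i, (a + d i) ^ p) ^ (2 / p) := by
  have hp0 : 0 < p := by linarith
  set φ : ℝ → ℝ := fun t => (∑ i, (a + t * d i) ^ p) ^ (2 / p) - (p - 1) * t ^ 2 * ∑ i, d i ^ 2
  have hmem (t : ℝ) (ht0 : 0 < t) (ht1 : t < 1) (i : ι) : 0 < a + t * d i := by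
    nlinarith [hpos i]
  have hderiv (t : ℝ) (ht0 : 0 < t) (ht1 : t < 1) : HasDerivAt φ
      (2 * ((∑ i, (a + t * d i) ^ p) ^ (2 / p - 1) * ∑ i, (a + t * d i) ^ (p - 1) * d i)
        - 2 * ((p - 1) * t * ∑ i, d i ^ 2)) t := by
    have hN0 : 0 < ∑ i, (a + t * d i) ^ p :=
      sum_pos (fun i _ => Real.rpow_pos_of_pos (hmem t ht0 ht1 i) p) univ_nonempty
    have h1 (i : ι) : HasDerivAt (fun t => (a + t * d i) ^ p)
        (d i * p * (a + t * d i) ^ (p - 1)) t := by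
      have : HasDerivAt (fun t => a + t * d i) (d i) t := by
        simpa using ((hasDerivAt_id t).mul_const (d i)).const_add a
      exact this.rpow_const (Or.inl (hmem t ht0 ht1 i).ne')
    have h2 := (HasDerivAt.fun_sum fun i (_ : i ∈ univ) => h1 i).rpow_const (p := 2 / p)
      (Or.inl hN0.ne')
    have h3 : HasDerivAt (fun t : ℝ => (p - 1) * t ^ 2 * ∑ i, d i ^ 2)
        ((p - 1) * (2 * t) * ∑ i, d i ^ 2) t := by
      simpa using (((hasDerivAt_pow 2 t).const_mul (p - 1)).mul_const (∑ i, d i ^ 2))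
    refine (h2.sub h3).congr_deriv ?_
    have : ∑ i, d i * p * (a + t * d i) ^ (p - 1) =
        p * ∑ i, (a + t * d i) ^ (p - 1) * d i := by
      rw [mul_sum]; exact sum_congr rfl fun i _ => by ring
    rw [this]; field_simp
  have hcont : ContinuousOn φ (Set.Icc 0 1) := by
    have : Continuous φ := by
      refine Continuous.sub (Continuous.rpow_const (continuous_finsetSum _ fun i _ =>
        Continuous.rpow_const (by fun_prop) fun _ => Or.inr hp0.le)
          fun _ => Or.inr (by positivity)) (by fun_prop)
    exact this.continuousOn
  have hmono : MonotoneOn φ (Set.Icc 0 1) := by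
    refine monotoneOn_of_deriv_nonneg (convex_Icc 0 1) hcont ?_ ?_
    · rw [interior_Icc]
      exact fun t ht => (hderiv t ht.1 ht.2).differentiableAt.differentiableWithinAt
    · rw [interior_Icc]
      intro t ht
      rw [(hderiv t ht.1 ht.2).deriv]
      have := two_uniform_convexity_deriv hp1 hp2 ha hd ht.1 (hmem t ht.1 ht.2)
      linarith
  have h01 := hmono (Set.left_mem_Icc.2 zero_le_one) (Set.right_mem_Icc.2 zero_le_one) zero_le_one
  have h0 : φ 0 = (Fintype.card ι : ℝ) ^ (2 / p) * a ^ 2 := by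
    simp only [φ, zero_mul, add_zero, sum_const, card_univ, nsmul_eq_mul]
    rw [Real.mul_rpow (by positivity) (by positivity), ← Real.rpow_mul ha.le,
      mul_div_cancel₀ _ hp0.ne']
    norm_num
  have h1 : φ 1 = (∑ i, (a + d i) ^ p) ^ (2 / p) - (p - 1) * ∑ i, d i ^ 2 := by
    simp [φ]
  linarith

lemma two_uniform_convexity [Nonempty ι] (hp1 : 1 < p) (hp2 : p ≤ 2) {f : ι → ℝ}
    (hf : ∀ i, 0 ≤ f i) {a : ℝ} (ha : ∑ i, f i = Fintype.card ι * a) :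
    (Fintype.card ι : ℝ) ^ (2 / p) * a ^ 2 + (p - 1) * ∑ i, (f i - a) ^ 2 ≤
      (∑ i, f i ^ p) ^ (2 / p) := by
  have hc : (0 : ℝ) < Fintype.card ι := by exact_mod_cast Fintype.card_pos
  have ha0 : 0 ≤ a := by
    have : 0 ≤ ∑ i, f i := sum_nonneg fun i _ => hf i
    rw [ha] at this
    exact nonneg_of_mul_nonneg_right this hc
  rcases ha0.eq_or_lt with rfl | ha0
  · have : ∀ i, f i = 0 := by
      simpa [sum_eq_zero_iff_of_nonneg fun i _ => hf i] using ha
    simp only [this, sub_zero]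
    norm_num
    positivity
  · simpa using two_uniform_convexity_of_sum_eq_zero hp1 hp2 ha0 (d := fun i => f i - a)
      (by simp [ha]) (by simpa using hf)

/-- The bilinear form of the noise operator `T_ρ` on a uniform finite space, scaled by the
cardinality of the space. -/
lemma noise_quadratic_le [Nonempty ι] (hp1 : 1 < p) (hp2 : p ≤ 2) {ρ : ℝ}
    (hρ : ρ ≤ (p - 1) * (Fintype.card ι : ℝ) ^ (1 - 2 / p)) {f : ι → ℝ} (hf : ∀ i, 0 ≤ f i) :
    ρ * ∑ i, f i ^ 2 + (1 - ρ) / Fintype.card ι * (∑ i, f i) ^ 2 ≤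
      (Fintype.card ι : ℝ) ^ (1 - 2 / p) * (∑ i, f i ^ p) ^ (2 / p) := by
  have hc : (0 : ℝ) < Fintype.card ι := by exact_mod_cast Fintype.card_pos
  set c : ℝ := (Fintype.card ι : ℝ)
  obtain ⟨a, ha⟩ : ∃ a, ∑ i, f i = c * a := ⟨(∑ i, f i) / c, by field_simp⟩
  have h := two_uniform_convexity hp1 hp2 hf ha
  have hvar : ∑ i, (f i - a) ^ 2 = ∑ i, f i ^ 2 - c * a ^ 2 := by
    simp only [sub_sq, sum_add_distrib, sum_sub_distrib, ← sum_mul, ← mul_sum, ha, sum_const,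
      card_univ, nsmul_eq_mul]
    ring
  have hC : c ^ (1 - 2 / p) * c ^ (2 / p) = c := by
    rw [← Real.rpow_add hc]; simp
  calc ρ * ∑ i, f i ^ 2 + (1 - ρ) / c * (∑ i, f i) ^ 2
      = c * a ^ 2 + ρ * ∑ i, (f i - a) ^ 2 := by rw [hvar, ha]; field_simp; ring
    _ ≤ c * a ^ 2 + (p - 1) * c ^ (1 - 2 / p) * ∑ i, (f i - a) ^ 2 := by
        gcongr
    _ = c ^ (1 - 2 / p) * (c ^ (2 / p) * a ^ 2 + (p - 1) * ∑ i, (f i - a) ^ 2) := by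
        rw [mul_add, ← mul_assoc, hC]; ring
    _ ≤ _ := by gcongr

/-- The kernel of the noise operator `T_ρ` on a uniform finite space. -/
noncomputable def noiseKernel [DecidableEq ι] (ρ : ℝ) (x y : ι) : ℝ :=
  (if x = y then ρ else 0) + (1 - ρ) / Fintype.card ι

lemma noiseKernel_nonneg [DecidableEq ι] {ρ : ℝ} (hρ0 : 0 ≤ ρ) (hρ1 : ρ ≤ 1) (x y : ι) :
    0 ≤ noiseKernel ρ x y := by
  have : 0 ≤ 1 - ρ := by linarith
  unfold noiseKernel
  split_ifs <;> positivity

lemma sum_noiseKernel [DecidableEq ι] (ρ : ℝ) (f g : ι → ℝ) :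
    ∑ x, ∑ y, f x * g y * noiseKernel ρ x y =
      ρ * ∑ i, f i * g i + (1 - ρ) / Fintype.card ι * ((∑ i, f i) * ∑ i, g i) := by
  simp only [noiseKernel, mul_add, sum_add_distrib, mul_ite, mul_zero, sum_ite_eq, mem_univ,
    if_true, ← sum_mul]
  rw [← sum_mul_sum]
  ring

lemma noise_bilinear_le [DecidableEq ι] [Nonempty ι] (hp1 : 1 < p) (hp2 : p ≤ 2) {ρ : ℝ}
    (hρ0 : 0 ≤ ρ) (hρ1 : ρ ≤ 1) (hρ : ρ ≤ (p - 1) * (Fintype.card ι : ℝ) ^ (1 - 2 / p))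
    {f g : ι → ℝ} (hf : ∀ i, 0 ≤ f i) (hg : ∀ i, 0 ≤ g i) :
    ∑ x, ∑ y, f x * g y * noiseKernel ρ x y ≤
      (Fintype.card ι : ℝ) ^ (1 - 2 / p) * (∑ i, f i ^ p) ^ p⁻¹ * (∑ i, g i ^ p) ^ p⁻¹ := by
  rw [sum_noiseKernel]
  have hF := noise_quadratic_le hp1 hp2 hρ hf
  have hG := noise_quadratic_le hp1 hp2 hρ hg
  have hsq {h : ι → ℝ} (hh : ∀ i, 0 ≤ h i) :
      (∑ i, h i ^ p) ^ (2 / p) = ((∑ i, h i ^ p) ^ p⁻¹) ^ 2 := by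
    rw [← Real.rpow_mul_natCast (sum_nonneg fun i _ => Real.rpow_nonneg (hh i) p)]
    congr 1
    push_cast
    ring
  rw [hsq hf] at hF
  rw [hsq hg] at hG
  have hF0 : 0 ≤ (∑ i, f i ^ p) ^ p⁻¹ :=
    Real.rpow_nonneg (sum_nonneg fun i _ => Real.rpow_nonneg (hf i) p) _
  have hG0 : 0 ≤ (∑ i, g i ^ p) ^ p⁻¹ :=
    Real.rpow_nonneg (sum_nonneg fun i _ => Real.rpow_nonneg (hg i) p) _
  have hk : 0 ≤ (1 - ρ) / Fintype.card ι := div_nonneg (by linarith) (by positivity)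
  have hC : 0 ≤ (Fintype.card ι : ℝ) ^ (1 - 2 / p) := by positivity
  have hCS := sum_mul_sq_le_sq_mul_sq univ f g
  have hS : 0 ≤ ∑ i, f i ^ 2 := sum_nonneg fun i _ => sq_nonneg _
  have hT : 0 ≤ ∑ i, g i ^ 2 := sum_nonneg fun i _ => sq_nonneg _
  generalize (∑ i, f i ^ p) ^ p⁻¹ = F at *
  generalize (∑ i, g i ^ p) ^ p⁻¹ = G at *
  generalize (1 - ρ) / (Fintype.card ι : ℝ) = k at *
  generalize (Fintype.card ι : ℝ) ^ (1 - 2 / p) = C at *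
  generalize ∑ i, f i * g i = R at *
  generalize ∑ i, f i ^ 2 = S at *
  generalize ∑ i, g i ^ 2 = T at *
  generalize ∑ i, f i = u at *
  generalize ∑ i, g i = v at *
  have hcross : 2 * R * (u * v) ≤ S * v ^ 2 + T * u ^ 2 := by
    have h1 : (2 * R * (u * v)) ^ 2 ≤ (S * v ^ 2 + T * u ^ 2) ^ 2 := by
      nlinarith [sq_nonneg (S * v ^ 2 - T * u ^ 2),
        mul_le_mul_of_nonneg_right hCS (sq_nonneg (u * v))]
    exact (abs_le_of_sq_le_sq' h1 (by positivity)).2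
  have hmain : (ρ * R + k * (u * v)) ^ 2 ≤ (C * F * G) ^ 2 := by
    calc (ρ * R + k * (u * v)) ^ 2 ≤ (ρ * S + k * u ^ 2) * (ρ * T + k * v ^ 2) := by
          nlinarith [mul_le_mul_of_nonneg_left hcross (mul_nonneg hρ0 hk),
            mul_le_mul_of_nonneg_left hCS (mul_nonneg hρ0 hρ0)]
      _ ≤ (C * F ^ 2) * (C * G ^ 2) := by gcongr
      _ = _ := by ring
  exact (abs_le_of_sq_le_sq' hmain (by positivity)).2

/-- Nonnegative kernels bounded on `ℓ^p` in the bilinear sense tensorize. -/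
lemma sum_prod_kernel_le (hp : 0 < p) {K : ι → ι → ℝ} (hK : ∀ x y, 0 ≤ K x y) {C : ℝ} (hC : 0 ≤ C)
    (h : ∀ f g : ι → ℝ, (∀ i, 0 ≤ f i) → (∀ i, 0 ≤ g i) → ∑ x, ∑ y, f x * g y * K x y ≤
      C * (∑ i, f i ^ p) ^ p⁻¹ * (∑ i, g i ^ p) ^ p⁻¹) (n : ℕ) :
    ∀ f g : (Fin n → ι) → ℝ, (∀ x, 0 ≤ f x) → (∀ x, 0 ≤ g x) →
      ∑ x, ∑ y, f x * g y * ∏ i, K (x i) (y i) ≤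
        C ^ n * (∑ x, f x ^ p) ^ p⁻¹ * (∑ x, g x ^ p) ^ p⁻¹ := by
  have hsplit (m : ℕ) (f : (Fin (m + 1) → ι) → ℝ) :
      ∑ x, f x = ∑ a, ∑ x : Fin m → ι, f (Fin.cons a x) := by
    rw [← (Fin.consEquiv fun _ => ι).sum_comp, Fintype.sum_prod_type]
    rfl
  induction n with
  | zero =>
    intro f g hf hg
    simp [← Real.rpow_mul (hf _), ← Real.rpow_mul (hg _), mul_inv_cancel₀ hp.ne']
  | succ n ih =>
    intro f g hf hg
    have hpow {f : (Fin (n + 1) → ι) → ℝ} (hf : ∀ x, 0 ≤ f x) (a : ι) :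
        ((∑ x : Fin n → ι, f (Fin.cons a x) ^ p) ^ p⁻¹) ^ p =
          ∑ x : Fin n → ι, f (Fin.cons a x) ^ p :=
      Real.rpow_inv_rpow (sum_nonneg fun x _ => Real.rpow_nonneg (hf _) p) hp.ne'
    have hnn {f : (Fin (n + 1) → ι) → ℝ} (hf : ∀ x, 0 ≤ f x) (a : ι) :
        0 ≤ (∑ x : Fin n → ι, f (Fin.cons a x) ^ p) ^ p⁻¹ :=
      Real.rpow_nonneg (sum_nonneg fun x _ => Real.rpow_nonneg (hf _) p) _
    have hbase := h _ _ (hnn hf) (hnn hg)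
    simp only [hpow hf, hpow hg] at hbase
    simp only [hsplit, Fin.prod_univ_succ, Fin.cons_zero, Fin.cons_succ]
    calc ∑ a, ∑ x : Fin n → ι, ∑ b, ∑ y : Fin n → ι,
          f (Fin.cons a x) * g (Fin.cons b y) * (K a b * ∏ i, K (x i) (y i))
        = ∑ a, ∑ b, K a b * ∑ x : Fin n → ι, ∑ y : Fin n → ι,
          f (Fin.cons a x) * g (Fin.cons b y) * ∏ i, K (x i) (y i) := by
          refine sum_congr rfl fun a _ => ?_
          rw [sum_comm]
          refine sum_congr rfl fun b _ => ?_
          simp only [mul_sum]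
          exact sum_congr rfl fun x _ => sum_congr rfl fun y _ => by ring
      _ ≤ ∑ a, ∑ b, K a b * (C ^ n * (∑ x : Fin n → ι, f (Fin.cons a x) ^ p) ^ p⁻¹ *
          (∑ x : Fin n → ι, g (Fin.cons b x) ^ p) ^ p⁻¹) := by
          gcongr with a _ b _
          · exact hK a b
          · exact ih _ _ (fun _ => hf _) (fun _ => hg _)
      _ = C ^ n * ∑ a, ∑ b, (∑ x : Fin n → ι, f (Fin.cons a x) ^ p) ^ p⁻¹ *
          (∑ x : Fin n → ι, g (Fin.cons b x) ^ p) ^ p⁻¹ * K a b := by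
          simp only [mul_sum]
          exact sum_congr rfl fun x _ => sum_congr rfl fun y _ => by ring
      _ ≤ C ^ n * _ := mul_le_mul_of_nonneg_left hbase (by positivity)
      _ = _ := by ring

end Hypercontractivity

theorem stmt15 {s n : ℕ} (hs : 2 ≤ s) [NeZero s] (hn : 1 ≤ n)
    (A : Finset (Fin n → ZMod s)) (δ : ℝ) (hδ : δ = (A.card : ℝ) / s ^ n)
    (q ρ ν : ℝ) (hq : 2 ≤ q) (hρ0 : 0 ≤ ρ)
    (hρ1 : ρ ≤ (1 / (q - 1)) * (1 / s) ^ ((1 : ℝ) - 2 / q))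
    (hν : ν = (1 - 1 / s) * (1 - ρ)) :
    (∑ x : Fin n → ZMod s, ∑ μ : Fin n → ZMod s,
        (if x ∈ A ∧ x + μ ∈ A then
          ∏ i, (if μ i = 0 then 1 - ν else ν / ((s : ℝ) - 1)) else 0))
      / (s : ℝ) ^ n
      ≤ δ ^ (2 - 2 / q) := by
  have hs' : (2 : ℝ) ≤ s := by exact_mod_cast hs
  have hs0 : (0 : ℝ) < s := by linarith
  have hs1 : (s : ℝ) - 1 ≠ 0 := by linarith
  have hq1 : 0 < q - 1 := by linarith
  have hq0 : q ≠ 0 := by linarith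
  set p : ℝ := q / (q - 1) with hp
  have hp1 : 1 < p := by rw [hp, lt_div_iff₀ hq1]; linarith
  have hp2 : p ≤ 2 := by rw [hp, div_le_iff₀ hq1]; linarith
  have hp0 : 0 < p := by linarith
  have hpq : p - 1 = 1 / (q - 1) := by rw [hp]; field_simp; ring
  have h2p : 2 / p = 2 - 2 / q := by rw [hp]; field_simp
  have hρ : ρ ≤ (p - 1) * (Fintype.card (ZMod s) : ℝ) ^ (1 - 2 / p) := by
    rw [ZMod.card, hpq]
    convert hρ1 using 2
    rw [one_div, Real.inv_rpow hs0.le, ← Real.rpow_neg hs0.le, h2p]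
    congr 1
    ring
  have hρle : ρ ≤ 1 := by
    refine hρ.trans (mul_le_one₀ (by linarith) (by positivity) ?_)
    rw [ZMod.card]
    refine Real.rpow_le_one_of_one_le_of_nonpos (by linarith) ?_
    have : 1 ≤ 2 / p := by rwa [le_div_iff₀ hp0, one_mul]
    linarith
  have hkernel (x z : ZMod s) :
      (if z = 0 then 1 - ν else ν / ((s : ℝ) - 1)) = noiseKernel ρ x (x + z) := by
    simp only [noiseKernel, ZMod.card, left_eq_add]
    split_ifs
    · rw [hν]; field_simp; ring
    · rw [hν]; field_simp; ring
  have hT := sum_prod_kernel_le hp0 (noiseKernel_nonneg (ι := ZMod s) hρ0 hρle)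
    (C := (Fintype.card (ZMod s) : ℝ) ^ (1 - 2 / p)) (by positivity)
    (fun f g hf hg => noise_bilinear_le hp1 hp2 hρ0 hρle hρ hf hg) n
    (fun x => if x ∈ A then 1 else 0) (fun x => if x ∈ A then 1 else 0)
    (fun x => by positivity) (fun x => by positivity)
  have hsum : ∑ x : Fin n → ZMod s, ∑ μ : Fin n → ZMod s,
        (if x ∈ A ∧ x + μ ∈ A then
          ∏ i, (if μ i = 0 then 1 - ν else ν / ((s : ℝ) - 1)) else 0) =
      ∑ x : Fin n → ZMod s, ∑ y : Fin n → ZMod s,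
        (if x ∈ A then 1 else 0) * (if y ∈ A then 1 else 0) *
          ∏ i, noiseKernel ρ (x i) (y i) := by
    refine sum_congr rfl fun x _ => ?_
    refine Fintype.sum_equiv (Equiv.addLeft x) _ _ fun μ => ?_
    rw [prod_congr rfl fun i _ => hkernel (x i) (μ i)]
    by_cases hx : x ∈ A <;> by_cases hy : x + μ ∈ A <;> simp [hx, hy]
  have hcard : ∑ x : Fin n → ZMod s, (if x ∈ A then (1 : ℝ) else 0) ^ p = A.card := by
    simp [ite_pow, Real.zero_rpow hp0.ne']
  rw [hcard, ZMod.card, mul_assoc, ← Real.rpow_add_of_nonneg (by positivity) (by positivity)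
    (by positivity), show p⁻¹ + p⁻¹ = 2 / p by ring] at hT
  rw [hsum, hδ, ← h2p, Real.div_rpow (by positivity) (by positivity)]
  have hexp : ((s : ℝ) ^ (1 - 2 / p)) ^ n * ((s : ℝ) ^ n) ^ (2 / p) = (s : ℝ) ^ n := by
    rw [Real.rpow_pow_comm hs0.le, ← Real.rpow_add (by positivity)]
    simp
  rw [div_le_div_iff₀ (by positivity) (by positivity)]
  calc _ ≤ ((s : ℝ) ^ (1 - 2 / p)) ^ n * (A.card : ℝ) ^ (2 / p) * ((s : ℝ) ^ n) ^ (2 / p) := by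
        gcongr
    _ = (A.card : ℝ) ^ (2 / p) * (((s : ℝ) ^ (1 - 2 / p)) ^ n * ((s : ℝ) ^ n) ^ (2 / p)) := by ring
    _ = _ := by rw [hexp]
end
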